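/- arXiv:1206.0867 — 5 statements merged into one kernel-verified Lean document; each statement's English description precedes it below -/
import Mathlib

section
/- Let a > 0, b > 0 and let (c,d) be the unique pair with 0 < d < c, c² + d² = a + b(1+h²)/(1−y₂)², c·d = b·h/(1−y₂)². Then lim_{r→1⁺} (1/(4πi)) ∮_{|ζ|=1} log(a + b·z(ζ)) · [1/(ζ − 1/r) + 1/(ζ + 1/r) − 2/(ζ + y₂/h)] dζ = (1/2)·log( (c²−d²)h² / (ch − y₂d)² ), where the contour integral is taken counterclockwise over the unit circle. -/
open Real Filter

lemma aux_re_pos (c d : ℝ) (hd0 : 0 < d) (hdc : d < c) (z : ℂ) (hz : ‖z‖ ≤ 1) :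
    0 < ((c : ℂ) + d * z).re := by
  have h1 := Complex.abs_re_le_norm z
  have h2 := (abs_le.1 (h1.trans hz)).1
  simp
  nlinarith

lemma aux_diff (c d : ℝ) (hd0 : 0 < d) (hdc : d < c) (z : ℂ) (hz : ‖z‖ ≤ 1) :
    DifferentiableAt ℂ (fun z : ℂ => Complex.log ((c : ℂ) + d * z)) z := by
  refine DifferentiableAt.clog (by fun_prop) ?_
  exact Or.inl (aux_re_pos c d hd0 hdc z hz)

lemma aux_inv (f : ℂ → ℂ) :
    (∮ z in C(0, 1), f z) = ∮ z in C(0, 1), f z⁻¹ * (z⁻¹) ^ 2 := by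
  have key : ∀ θ : ℝ, circleMap 0 1 (2 * π - θ) = (circleMap 0 1 θ)⁻¹ := by
    intro θ
    simp only [circleMap, zero_add, Complex.ofReal_one, one_mul]
    rw [← Complex.exp_neg]
    push_cast
    rw [sub_mul, Complex.exp_sub, Complex.exp_two_pi_mul_I, Complex.exp_neg, one_div]
  simp only [circleIntegral, deriv_circleMap, smul_eq_mul]
  have := intervalIntegral.integral_comp_sub_left (a := 0) (b := 2 * π)
    (fun θ : ℝ => circleMap 0 1 θ * Complex.I * f (circleMap 0 1 θ)) (2 * π)
  simp only [sub_self, sub_zero] at this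
  rw [← this]
  congr 1
  ext θ
  rw [key]
  have h0 : circleMap 0 1 θ ≠ 0 := by simp [circleMap]
  field_simp

lemma aux_log (c d : ℝ) (hd0 : 0 < d) (hdc : d < c) (z : ℂ) (hz : ‖z‖ = 1) :
    Complex.log ((c ^ 2 + d ^ 2 + 2 * (c * d) * z.re : ℝ) : ℂ) =
      Complex.log ((c : ℂ) + d * z) + Complex.log ((c : ℂ) + d * z⁻¹) := by
  have hp := aux_re_pos c d hd0 hdc z hz.le
  have hinv : z⁻¹ = (starRingEnd ℂ) z := by
    rw [Complex.inv_def, Complex.normSq_eq_norm_sq, hz]; simp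
  have hc : (c : ℂ) + d * z⁻¹ = (starRingEnd ℂ) ((c : ℂ) + d * z) := by
    rw [hinv]; simp
  have harg : ((c : ℂ) + d * z).arg ≠ π := by
    intro h
    have := Complex.arg_eq_pi_iff.1 h
    linarith [this.1]
  have hne : (c : ℂ) + d * z ≠ 0 := by
    intro h; rw [h] at hp; simp at hp
  rw [hc, Complex.log_conj _ harg, Complex.add_conj, Complex.log_re]
  have hn : (c ^ 2 + d ^ 2 + 2 * (c * d) * z.re : ℝ) = ‖(c : ℂ) + d * z‖ ^ 2 := by
    rw [← Complex.normSq_eq_norm_sq, Complex.normSq_apply]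
    have : z.re * z.re + z.im * z.im = 1 := by
      rw [← Complex.normSq_apply, Complex.normSq_eq_norm_sq, hz]; norm_num
    simp
    linear_combination (-d ^ 2) * this
  rw [hn, ← Complex.ofReal_log (by positivity), Real.log_pow]
  simp

lemma aux_int (c d : ℝ) (hd0 : 0 < d) (hdc : d < c) (w : ℂ) (hw : ‖w‖ < 1) :
    CircleIntegrable (fun z : ℂ => Complex.log ((c : ℂ) + d * z) * (1 / (z - w))) 0 1 ∧
    CircleIntegrable (fun z : ℂ => Complex.log ((c : ℂ) + d * z⁻¹) * (1 / (z - w))) 0 1 := by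
  constructor <;>
  · apply ContinuousOn.circleIntegrable zero_le_one
    intro z hz
    have hz1 : ‖z‖ = 1 := by simpa using hz
    have h0 : z ≠ 0 := by rintro rfl; simp at hz1
    have h1 : z - w ≠ 0 := by
      intro h; rw [sub_eq_zero] at h; rw [← h] at hw; linarith
    apply ContinuousAt.continuousWithinAt
    apply ContinuousAt.mul
    · refine ContinuousAt.clog (by fun_prop (disch := assumption)) ?_
      exact Or.inl (aux_re_pos c d hd0 hdc _ (by simp [hz1]))
    · fun_prop (disch := assumption)

lemma aux_key (c d : ℝ) (hd0 : 0 < d) (hdc : d < c) (w : ℂ) (hw : ‖w‖ < 1) :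
    CircleIntegrable (fun z : ℂ => Complex.log ((c ^ 2 + d ^ 2 + 2 * (c * d) * z.re : ℝ) : ℂ)
      * (1 / (z - w))) 0 1 ∧
    (∮ z in C(0, 1), Complex.log ((c ^ 2 + d ^ 2 + 2 * (c * d) * z.re : ℝ) : ℂ)
      * (1 / (z - w))) =
      2 * π * Complex.I * (Complex.log ((c : ℂ) + d * w) + Complex.log c) := by
  obtain ⟨i1, i2⟩ := aux_int c d hd0 hdc w hw
  have heq : Set.EqOn (fun z : ℂ => Complex.log ((c ^ 2 + d ^ 2 + 2 * (c * d) * z.re : ℝ) : ℂ)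
      * (1 / (z - w))) (fun z : ℂ => Complex.log ((c : ℂ) + d * z) * (1 / (z - w)) +
        Complex.log ((c : ℂ) + d * z⁻¹) * (1 / (z - w))) (Metric.sphere 0 1) := by
    intro z hz
    simp only
    rw [aux_log c d hd0 hdc z (by simpa using hz), add_mul]
  constructor
  · refine (circleIntegrable_congr ?_).2 (i1.add i2)
    rw [abs_one]; exact heq
  rw [circleIntegral.integral_congr zero_le_one heq, circleIntegral.integral_add i1 i2, mul_add]
  congr 1
  · have hD : DifferentiableOn ℂ (fun z : ℂ => Complex.log ((c : ℂ) + d * z))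
        (Metric.closedBall 0 1) := fun z hz =>
      (aux_diff c d hd0 hdc z (by simpa using hz)).differentiableWithinAt
    have := hD.circleIntegral_sub_inv_smul (w := w) (by simpa using hw)
    simp only [smul_eq_mul] at this
    rw [← this]
    congr 1; ext z; rw [one_div, mul_comm]
  · rw [aux_inv]
    have hD : DifferentiableOn ℂ (fun z : ℂ => Complex.log ((c : ℂ) + d * z) / (1 - w * z))
        (Metric.closedBall 0 1) := by
      intro z hz
      have hz1 : ‖z‖ ≤ 1 := by simpa using hz
      refine ((aux_diff c d hd0 hdc z hz1).div (by fun_prop) ?_).differentiableWithinAt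
      intro h
      have h2 : w * z = 1 := (sub_eq_zero.1 h).symm
      have h3 : ‖w‖ * ‖z‖ = 1 := by rw [← norm_mul, h2]; simp
      nlinarith [norm_nonneg w, norm_nonneg z]
    have := hD.circleIntegral_sub_inv_smul (w := 0) (by simp)
    simp only [smul_eq_mul, mul_zero, add_zero, sub_zero, div_one] at this
    rw [← this]
    apply circleIntegral.integral_congr zero_le_one
    intro z hz
    have hz1 : ‖z‖ = 1 := by simpa using hz
    have h0 : z ≠ 0 := by rintro rfl; simp at hz1
    simp only [inv_inv]
    have h4 : z⁻¹ - w = (1 - w * z) / z := by field_simp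
    rw [h4, one_div_div]
    field_simp

/-- with `y₁, y₂ ∈ (0,1)`, `h = √(y₁+y₂−y₁y₂)`,
`z(ζ) = (1−y₂)^{−2}(1+h²+2h Re ζ)`, and `(c,d)` the unique pair with `0 < d < c`,
`c²+d² = a+b(1+h²)/(1−y₂)²`, `cd = bh/(1−y₂)²`, the limit as `r → 1⁺` of
`(1/(4πi)) ∮_{|ζ|=1} log(a+b z(ζ)) [1/(ζ−1/r)+1/(ζ+1/r)−2/(ζ+y₂/h)] dζ`
equals `(1/2) log((c²−d²)h²/(ch−y₂d)²)`. -/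
theorem stmt1 (y₁ y₂ : ℝ) (hy₁ : y₁ ∈ Set.Ioo (0 : ℝ) 1) (hy₂ : y₂ ∈ Set.Ioo (0 : ℝ) 1)
    (a b : ℝ) (ha : 0 < a) (hb : 0 < b)
    (h c d : ℝ)
    (hh : h = Real.sqrt (y₁ + y₂ - y₁ * y₂))
    (hd0 : 0 < d) (hdc : d < c)
    (hcd1 : c ^ 2 + d ^ 2 = a + b * (1 + h ^ 2) / (1 - y₂) ^ 2)
    (hcd2 : c * d = b * h / (1 - y₂) ^ 2) :
    Tendsto
      (fun r : ℝ =>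
        (1 / (4 * (π : ℂ) * Complex.I)) *
          ∮ ζ in C(0, 1),
            Complex.log ((a : ℂ) + (b : ℂ) * (((1 - y₂) ^ 2)⁻¹ * (1 + h ^ 2 + 2 * h * ζ.re) : ℝ)) *
              (1 / (ζ - 1 / (r : ℂ)) + 1 / (ζ + 1 / (r : ℂ)) - 2 / (ζ + (y₂ / h : ℝ))))
      (nhdsWithin 1 (Set.Ioi 1))
      (nhds (((1 / 2) * Real.log ((c ^ 2 - d ^ 2) * h ^ 2 / (c * h - y₂ * d) ^ 2) : ℝ) : ℂ)) := by
  obtain ⟨h10, h11⟩ := hy₁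
  obtain ⟨h20, h21⟩ := hy₂
  have hq : y₂ < y₁ + y₂ - y₁ * y₂ := by nlinarith
  have hh0 : 0 < h := by rw [hh]; exact Real.sqrt_pos.2 (by linarith)
  have hh2 : h ^ 2 = y₁ + y₂ - y₁ * y₂ := by rw [hh]; exact Real.sq_sqrt (by linarith)
  have hyh : y₂ < h := by nlinarith
  have hyh1 : y₂ / h < 1 := (div_lt_one hh0).2 hyh
  have hyh0 : 0 < y₂ / h := by positivity
  have hc0 : 0 < c := hd0.trans hdc
  have harg : ∀ ζ : ℂ, (a : ℂ) + (b : ℂ) * (((1 - y₂) ^ 2)⁻¹ * (1 + h ^ 2 + 2 * h * ζ.re) : ℝ)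
      = ((c ^ 2 + d ^ 2 + 2 * (c * d) * ζ.re : ℝ) : ℂ) := by
    intro ζ
    rw [hcd1, hcd2, ← Complex.ofReal_mul, ← Complex.ofReal_add]
    congr 1
    ring
  simp only [harg]
  set L : ℝ → ℂ := fun x => Complex.log ((c : ℂ) + d * (x : ℂ)) with hL
  have hLc : ∀ x : ℝ, |x| ≤ 1 → ContinuousAt L x := by
    intro x hx
    refine ContinuousAt.clog (by fun_prop) ?_
    exact Or.inl (aux_re_pos c d hd0 hdc _ (by simpa using hx))
  have hval : ∀ r : ℝ, 1 < r → (1 / (4 * (π : ℂ) * Complex.I)) *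
          (∮ ζ in C(0, 1), Complex.log ((c ^ 2 + d ^ 2 + 2 * (c * d) * ζ.re : ℝ) : ℂ) *
              (1 / (ζ - 1 / (r : ℂ)) + 1 / (ζ + 1 / (r : ℂ)) - 2 / (ζ + (y₂ / h : ℝ))))
        = 1 / 2 * (L r⁻¹ + L (-r⁻¹) - 2 * L (-(y₂ / h))) := by
    intro r hr
    have hr1 : |r⁻¹| < 1 := by
      rw [abs_of_pos (by positivity)]; exact inv_lt_one_of_one_lt₀ hr
    obtain ⟨i1, e1⟩ := aux_key c d hd0 hdc ((r⁻¹ : ℝ) : ℂ)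
      (by rw [Complex.norm_real]; exact hr1)
    obtain ⟨i2, e2⟩ := aux_key c d hd0 hdc ((-r⁻¹ : ℝ) : ℂ)
      (by rw [Complex.norm_real, norm_neg]; exact hr1)
    obtain ⟨i3, e3⟩ := aux_key c d hd0 hdc ((-(y₂ / h) : ℝ) : ℂ)
      (by rw [Complex.norm_real, norm_neg, Real.norm_of_nonneg hyh0.le]; exact hyh1)
    have i4 := i3.const_smul (a := (2 : ℂ))
    have hs := circleIntegral.integral_sub (i1.add i2) i4
    have hs2 := circleIntegral.integral_add i1 i2
    have hs3 := circleIntegral.integral_smul (2 : ℂ) (fun z : ℂ =>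
      Complex.log ((c ^ 2 + d ^ 2 + 2 * (c * d) * z.re : ℝ) : ℂ)
      * (1 / (z - ((-(y₂ / h) : ℝ) : ℂ)))) 0 1
    have hI : (∮ ζ in C(0, 1), Complex.log ((c ^ 2 + d ^ 2 + 2 * (c * d) * ζ.re : ℝ) : ℂ) *
              (1 / (ζ - 1 / (r : ℂ)) + 1 / (ζ + 1 / (r : ℂ)) - 2 / (ζ + (y₂ / h : ℝ))))
        = 2 * π * Complex.I * (L r⁻¹ + Complex.log c) + 2 * π * Complex.I *
          (L (-r⁻¹) + Complex.log c) - 2 * (2 * π * Complex.I *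
          (L (-(y₂ / h)) + Complex.log c)) := by
      rw [← e1, ← e2, ← e3, ← smul_eq_mul (2 : ℂ), ← hs3, ← hs2]
      refine Eq.trans ?_ hs
      congr 1
      ext z
      simp only [Pi.add_apply, Pi.smul_apply, smul_eq_mul, Complex.ofReal_neg, sub_neg_eq_add,
        Complex.ofReal_inv]
      ring
    rw [hI]
    have hpi : (π : ℂ) ≠ 0 := by exact_mod_cast Real.pi_ne_zero
    have hi := Complex.I_ne_zero
    field_simp
    ring
  have hinv : Tendsto (fun r : ℝ => r⁻¹) (nhdsWithin 1 (Set.Ioi 1)) (nhds 1) := by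
    have : ContinuousAt (fun r : ℝ => r⁻¹) 1 := by
      exact continuousAt_inv₀ one_ne_zero
    have h2 := this.tendsto
    rw [inv_one] at h2
    exact h2.mono_left nhdsWithin_le_nhds
  have t1 := (hLc 1 (by simp)).tendsto.comp hinv
  have t2 := (hLc (-1) (by simp)).tendsto.comp hinv.neg
  have t3 := ((t1.add t2).sub_const (2 * L (-(y₂ / h)))).const_mul (1 / 2 : ℂ)
  have hLr : ∀ x : ℝ, 0 < c + d * x → L x = ((Real.log (c + d * x) : ℝ) : ℂ) := by
    intro x hx
    rw [Complex.ofReal_log hx.le]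
    simp [hL]
  have p1 : 0 < c + d * 1 := by linarith
  have p2 : 0 < c + d * (-1) := by linarith
  have p3 : 0 < c + d * (-(y₂ / h)) := by nlinarith
  have hfin : (((1 / 2) * Real.log ((c ^ 2 - d ^ 2) * h ^ 2 / (c * h - y₂ * d) ^ 2) : ℝ) : ℂ)
      = 1 / 2 * (L 1 + L (-1) - 2 * L (-(y₂ / h))) := by
    rw [hLr _ p1, hLr _ p2, hLr _ p3]
    have e : (c ^ 2 - d ^ 2) * h ^ 2 / (c * h - y₂ * d) ^ 2
        = (c + d * 1) * (c + d * (-1)) / (c + d * (-(y₂ / h))) ^ 2 := by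
      have e3 : c + d * (-(y₂ / h)) = (c * h - y₂ * d) / h := by field_simp; ring
      have : c * h - y₂ * d ≠ 0 := by
        intro h0; rw [e3, h0] at p3; simp at p3
      rw [e3]
      field_simp
      ring
    rw [e, Real.log_div (by positivity) (by positivity), Real.log_mul p1.ne' p2.ne', Real.log_pow]
    push_cast
    ring
  rw [hfin]
  refine t3.congr' ?_
  filter_upwards [self_mem_nhdsWithin] with r hr
  exact (hval r hr).symm
end

section
/- Let a > 0, b > 0, α > 0, β > 0. Let (c,d) be the unique pair with 0 < d < c, c² + d² = a + b(1+h²)/(1−y₂)², c·d = b·h/(1−y₂)², and let (γ,η) be the analogous unique pair for (α,β), i.e. 0 < η < γ, γ² + η² = α + β(1+h²)/(1−y₂)², γ·η = β·h/(1−y₂)². Then lim_{r→1⁺} [ −(1/(2π²)) ∮_{|ζ₂|=1} ∮_{|ζ₁|=1} log(a + b·z(ζ₁)) · log(α + β·z(ζ₂)) · (ζ₁ − rζ₂)^{−2} dζ₁ dζ₂ ] = 2·log( cγ / (cγ − dη) ), where both contour integrals are taken counterclockwise over the unit circle. -/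
open Real Filter


lemma ci_inv (f : ℂ → ℂ) :
    (∮ z in C(0, 1), f z⁻¹) = ∮ z in C(0, 1), (z ^ 2)⁻¹ * f z := by
  simp only [circleIntegral]
  have key := intervalIntegral.integral_comp_sub_left (a := 0) (b := 2 * π)
    (fun θ : ℝ => deriv (circleMap 0 1) θ • ((circleMap 0 1 θ ^ 2)⁻¹ * f (circleMap 0 1 θ))) (2 * π)
  simp only [sub_self, sub_zero] at key
  rw [← key]
  refine intervalIntegral.integral_congr fun θ _ => ?_
  have h1 : circleMap 0 1 (2 * π - θ) = (circleMap 0 1 θ)⁻¹ := by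
    rw [circleMap_zero_inv, inv_one]
    have := periodic_circleMap (0 : ℂ) 1 (-θ)
    rw [← this]; congr 1; ring
  have h0 : circleMap 0 1 θ ≠ 0 := by simp [circleMap]
  simp only [deriv_circleMap, h1, smul_eq_mul]
  field_simp

lemma slit {q : ℝ} (hq0 : 0 < q) {u : ℂ} (hu : q * ‖u‖ < 1) :
    (1 + (q : ℂ) * u) ∈ Complex.slitPlane := by
  apply Complex.mem_slitPlane_of_norm_lt_one
  simpa [abs_of_pos hq0] using hu

lemma log_split {c d : ℝ} (hd0 : 0 < d) (hdc : d < c) {ζ : ℂ} (hζ : ‖ζ‖ = 1) (x : ℝ)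
    (hx : x = c ^ 2 + d ^ 2 + 2 * (c * d) * ζ.re) :
    Complex.log (x : ℂ) = ((2 * Real.log c : ℝ) : ℂ)
      + Complex.log (1 + ((d / c : ℝ) : ℂ) * ζ) + Complex.log (1 + ((d / c : ℝ) : ℂ) * ζ⁻¹) := by
  have hc : 0 < c := hd0.trans hdc
  have hq0 : 0 < d / c := by positivity
  have hq1 : d / c < 1 := (div_lt_one hc).2 hdc
  have hs : (1 + ((d / c : ℝ) : ℂ) * ζ) ∈ Complex.slitPlane := slit hq0 (by rw [hζ]; linarith)
  have hinv : ζ⁻¹ = (starRingEnd ℂ) ζ := Complex.inv_eq_conj hζ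
  have hcj : (1 + ((d / c : ℝ) : ℂ) * ζ⁻¹) = (starRingEnd ℂ) (1 + ((d / c : ℝ) : ℂ) * ζ) := by
    rw [hinv, map_add, map_mul, Complex.conj_ofReal, map_one]
  rw [hcj, Complex.log_conj _ (Complex.mem_slitPlane_iff_arg.1 hs).1, add_assoc, Complex.add_conj,
    Complex.log_re]
  have hn := Complex.slitPlane_ne_zero hs
  have hn' : 0 < ‖(1 + ((d / c : ℝ) : ℂ) * ζ)‖ := norm_pos_iff.2 hn
  have hsq : ζ.re * ζ.re + ζ.im * ζ.im = 1 := by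
    rw [← Complex.normSq_apply, Complex.normSq_eq_norm_sq, hζ]; norm_num
  have hxe : x = (c * ‖(1 + ((d / c : ℝ) : ℂ) * ζ)‖) ^ 2 := by
    rw [mul_pow, ← Complex.normSq_eq_norm_sq, Complex.normSq_apply, hx]
    simp only [Complex.add_re, Complex.add_im, Complex.one_re, Complex.one_im, Complex.re_ofReal_mul,
      Complex.im_ofReal_mul]
    field_simp
    linear_combination (-d ^ 2) * hsq
  rw [← Complex.ofReal_log (by rw [hxe]; positivity), hxe, Real.log_pow,
    Real.log_mul hc.ne' hn'.ne']
  push_cast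
  ring

lemma log_diffAt {q : ℝ} (hq0 : 0 < q) {u : ℂ} (hu : q * ‖u‖ < 1) :
    HasDerivAt (fun z : ℂ => Complex.log (1 + (q : ℂ) * z)) (q / (1 + (q : ℂ) * u)) u := by
  have h1 : HasDerivAt (fun z : ℂ => 1 + (q : ℂ) * z) (q : ℂ) u := by
    simpa using ((hasDerivAt_id u).const_mul (q : ℂ)).const_add 1
  exact h1.clog (slit hq0 hu)

lemma log_diffOn {q : ℝ} (hq0 : 0 < q) (hq1 : q < 1) :
    DifferentiableOn ℂ (fun z : ℂ => Complex.log (1 + (q : ℂ) * z)) (Metric.closedBall 0 1) := by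
  intro u hu
  have hu' : ‖u‖ ≤ 1 := by simpa using hu
  exact (log_diffAt hq0 (by nlinarith [norm_nonneg u])).differentiableAt.differentiableWithinAt

lemma inv_mem {u : ℂ} (hu : u ∈ Metric.sphere (0 : ℂ) 1) :
    u⁻¹ ∈ Metric.closedBall (0 : ℂ) 1 ∧ u ≠ 0 := by
  have : ‖u‖ = 1 := by simpa using hu
  constructor
  · simp [this]
  · rw [← norm_pos_iff, this]; norm_num

lemma split_int {q : ℝ} (hq0 : 0 < q) (hq1 : q < 1) (K : ℂ) (k : ℂ → ℂ)
    (hk : ContinuousOn k (Metric.sphere 0 1)) :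
    (∮ z in C(0, 1), (K + Complex.log (1 + q * z) + Complex.log (1 + q * z⁻¹)) * k z)
    = (∮ z in C(0, 1), (K + Complex.log (1 + q * z)) * k z) +
      ∮ z in C(0, 1), (z ^ 2)⁻¹ * (Complex.log (1 + q * z) * k z⁻¹) := by
  have hl := (log_diffOn hq0 hq1).continuousOn
  have hl1 := hl.mono (Metric.sphere_subset_closedBall)
  rw [← ci_inv (fun z => Complex.log (1 + q * z) * k z⁻¹), ← circleIntegral.integral_add]
  · refine circleIntegral.integral_congr zero_le_one fun z _ => ?_
    simp only [inv_inv]; ring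
  · refine ContinuousOn.circleIntegrable zero_le_one ?_
    exact (continuousOn_const.add hl1).mul hk
  · refine ContinuousOn.circleIntegrable zero_le_one ?_
    simp only [inv_inv]
    refine ContinuousOn.mul ?_ hk
    refine hl.comp (f := fun z : ℂ => z⁻¹) ?_ fun u hu => (inv_mem hu).1
    exact continuousOn_id.inv₀ fun u hu => (inv_mem hu).2

lemma zero_int (f : ℂ → ℂ) (hf : DifferentiableOn ℂ f (Metric.closedBall 0 1)) :
    (∮ z in C(0, 1), f z) = 0 :=
  ((hf.mono Metric.closure_ball_subset_closedBall).diffContOnCl).circleIntegral_eq_zero zero_le_one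

lemma inner_int {q : ℝ} (hq0 : 0 < q) (hq1 : q < 1) (K w : ℂ) (hw : 1 < ‖w‖) :
    (∮ z in C(0, 1), (K + Complex.log (1 + q * z) + Complex.log (1 + q * z⁻¹)) * ((z - w) ^ 2)⁻¹)
    = 2 * π * Complex.I * (q / (w * (w + q))) := by
  have hne : ∀ z ∈ Metric.closedBall (0 : ℂ) 1, (z - w) ^ 2 ≠ 0 := by
    intro z hz
    have hz' : ‖z‖ ≤ 1 := by simpa using hz
    apply pow_ne_zero
    rw [sub_ne_zero]; rintro rfl; linarith
  have hd : DifferentiableOn ℂ (fun z : ℂ => ((z - w) ^ 2)⁻¹) (Metric.closedBall 0 1) :=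
    DifferentiableOn.inv (by fun_prop) hne
  have hw0 : w ≠ 0 := by rw [← norm_pos_iff]; linarith
  have hwi : ‖w⁻¹‖ < 1 := by rw [norm_inv]; exact inv_lt_one_of_one_lt₀ hw
  rw [split_int hq0 hq1 K (fun z => ((z - w) ^ 2)⁻¹)
    (hd.continuousOn.mono Metric.sphere_subset_closedBall),
    zero_int (fun z => (K + Complex.log (1 + q * z)) * ((z - w) ^ 2)⁻¹) (((differentiableOn_const K).add (log_diffOn hq0 hq1)).mul hd), zero_add]
  have hC := Complex.two_pi_I_inv_smul_circleIntegral_sub_sq_inv_smul_of_differentiable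
    (U := Metric.ball (0 : ℂ) (1 / q)) Metric.isOpen_ball (c := 0) (w₀ := w⁻¹) (R := 1)
    (f := fun z : ℂ => Complex.log (1 + (q : ℂ) * z))
    (Metric.closedBall_subset_ball (by rw [lt_div_iff₀ hq0]; linarith))
    (fun u hu => by
      have hu' : ‖u‖ < 1 / q := by simpa using hu
      rw [lt_div_iff₀ hq0] at hu'
      exact (log_diffAt hq0 (by linarith)).differentiableAt.differentiableWithinAt)
    (by simpa using hwi)
  have hq' : q * ‖w⁻¹‖ < 1 := by nlinarith [norm_nonneg w⁻¹]
  rw [(log_diffAt hq0 hq').deriv, smul_eq_mul, inv_mul_eq_iff_eq_mul₀ Complex.two_pi_I_ne_zero] at hC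
  have h2 : (∮ z in C(0, 1), (z ^ 2)⁻¹ * (Complex.log (1 + q * z) * ((z⁻¹ - w) ^ 2)⁻¹))
      = ∮ z in C(0, 1), (w ^ 2)⁻¹ * (((z - w⁻¹) ^ 2)⁻¹ • Complex.log (1 + q * z)) := by
    refine circleIntegral.integral_congr zero_le_one fun z hz => ?_
    have hz0 := (inv_mem hz).2
    have e : (w * (z - w⁻¹)) ^ 2 = (z * (z⁻¹ - w)) ^ 2 := by
      field_simp; ring
    simp only [smul_eq_mul]
    calc _ = ((z * (z⁻¹ - w)) ^ 2)⁻¹ * Complex.log (1 + q * z) := by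
            rw [mul_pow, mul_inv]; ring
      _ = _ := by rw [← e, mul_pow, mul_inv]; ring
  rw [h2, circleIntegral.integral_const_mul, hC]
  have hs := Complex.slitPlane_ne_zero (slit hq0 hq')
  have e : w * (w + q) = w ^ 2 * (1 + q * w⁻¹) := by field_simp
  rw [e]
  field_simp

lemma outer_int {p q r : ℝ} (hp0 : 0 < p) (hp1 : p < 1) (hq0 : 0 < q) (hq1 : q < 1) (hr : 1 < r)
    (K : ℂ) :
    (∮ z in C(0, 1), (K + Complex.log (1 + p * z) + Complex.log (1 + p * z⁻¹)) *
      (q / ((r * z) * (r * z + q))))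
    = 2 * π * Complex.I * (-((r⁻¹ * Real.log (1 - p * q / r) : ℝ) : ℂ)) := by
  have hr0 : 0 < r := by linarith
  have hrc : (r : ℂ) ≠ 0 := by exact_mod_cast hr0.ne'
  have hqr : q / r < 1 := by rw [div_lt_one hr0]; linarith
  have hqr0 : 0 < q / r := by positivity
  have h1 : ∀ z ∈ Metric.closedBall (0 : ℂ) 1, (r : ℂ) + q * z ≠ 0 := by
    intro z hz h
    have hz' : ‖z‖ ≤ 1 := by simpa using hz
    have : (r : ℂ) = -(q * z) := by linear_combination h
    have h2 := congrArg norm this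
    rw [norm_neg, norm_mul, Complex.norm_real, Complex.norm_real, Real.norm_of_nonneg hr0.le,
      Real.norm_of_nonneg hq0.le] at h2
    nlinarith [norm_nonneg z]
  have h2 : ∀ z ∈ Metric.sphere (0 : ℂ) 1, (r : ℂ) * z + q ≠ 0 := by
    intro z hz h
    have hi := inv_mem hz
    apply h1 _ hi.1
    have := hi.2
    field_simp
    linear_combination h
  have hk : ContinuousOn (fun z : ℂ => (q : ℂ) / ((r * z) * (r * z + q))) (Metric.sphere 0 1) := by
    refine ContinuousOn.div (by fun_prop) (by fun_prop) fun z hz => ?_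
    exact mul_ne_zero (mul_ne_zero hrc (inv_mem hz).2) (h2 z hz)
  rw [split_int hp0 hp1 K _ hk]
  have hz2 : (∮ z in C(0, 1), (z ^ 2)⁻¹ * (Complex.log (1 + p * z) *
      (q / ((r * z⁻¹) * (r * z⁻¹ + q))))) = 0 := by
    refine Eq.trans ?_ (zero_int (fun z : ℂ => Complex.log (1 + p * z) * ((q : ℂ) / (r * (r + q * z)))) ?_)
    · refine circleIntegral.integral_congr zero_le_one fun z hz => ?_
      have hz0 := (inv_mem hz).2
      have h3 := h1 z (Metric.sphere_subset_closedBall hz)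
      have e : (r * z⁻¹) * (r * z⁻¹ + q) = (z ^ 2)⁻¹ * ((r : ℂ) * (r + q * z)) := by
        field_simp
      simp only [e]
      field_simp
    · refine (log_diffOn hp0 hp1).mul (DifferentiableOn.div (by fun_prop) (by fun_prop) fun z hz => ?_)
      exact mul_ne_zero hrc (h1 z hz)
  rw [hz2, add_zero]
  have hD : DifferentiableOn ℂ (fun z : ℂ => K + Complex.log (1 + p * z)) (Metric.closedBall 0 1) :=
    (differentiableOn_const K).add (log_diffOn hp0 hp1)
  have hm : (-((q / r : ℝ) : ℂ)) ∈ Metric.ball (0 : ℂ) 1 := by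
    rw [mem_ball_zero_iff, norm_neg, Complex.norm_real, Real.norm_of_nonneg hqr0.le]; exact hqr
  have hA := hD.circleIntegral_sub_inv_smul (w := 0) (by simp)
  have hB := hD.circleIntegral_sub_inv_smul (w := -((q / r : ℝ) : ℂ)) hm
  have hne : ∀ w ∈ Metric.ball (0 : ℂ) 1, ∀ z ∈ Metric.sphere (0 : ℂ) 1, z - w ≠ 0 := by
    intro w hw z hz h
    rw [sub_eq_zero] at h
    rw [mem_ball_zero_iff] at hw
    rw [mem_sphere_zero_iff_norm, h] at hz
    linarith
  have hI : ∀ w ∈ Metric.ball (0 : ℂ) 1, CircleIntegrable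
      (fun z : ℂ => (z - w)⁻¹ • (K + Complex.log (1 + p * z))) 0 1 := by
    intro w hw
    refine ContinuousOn.circleIntegrable zero_le_one ?_
    exact (ContinuousOn.inv₀ (by fun_prop) (hne w hw)).smul
      (hD.continuousOn.mono Metric.sphere_subset_closedBall)
  have h3 : (∮ z in C(0, 1), (K + Complex.log (1 + p * z)) * (q / ((r * z) * (r * z + q))))
     = ∮ z in C(0, 1), (r : ℂ)⁻¹ * ((z - 0)⁻¹ • (K + Complex.log (1 + p * z)) -
        (z - -((q / r : ℝ) : ℂ))⁻¹ • (K + Complex.log (1 + p * z))) := by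
    refine circleIntegral.integral_congr zero_le_one fun z hz => ?_
    have hz0 := (inv_mem hz).2
    have h4 := h2 z hz
    have e : z - -((q / r : ℝ) : ℂ) = (r * z + q) / r := by
      push_cast; field_simp; ring
    simp only [e, smul_eq_mul, sub_zero]
    generalize Complex.log (1 + p * z) = M
    generalize hDD : (r : ℂ) * z + q = D at h4
    have hq : (q : ℂ) = D - r * z := by rw [← hDD]; ring
    rw [hq]
    field_simp
  rw [h3, circleIntegral.integral_const_mul,
    circleIntegral.integral_sub (hI 0 (by simp)) (hI _ hm), hA, hB]
  have hpos : 0 < 1 - p * q / r := by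
    have : p * (q / r) < 1 := by nlinarith
    rw [mul_div_assoc]; linarith
  have e : (1 + (p : ℂ) * -((q / r : ℝ) : ℂ)) = ((1 - p * q / r : ℝ) : ℂ) := by
    push_cast; ring
  rw [e, ← Complex.ofReal_log hpos.le]
  simp only [smul_eq_mul, mul_zero, add_zero, Complex.log_one]
  push_cast
  ring

/-- with `y₁, y₂ ∈ (0,1)`, `h = √(y₁+y₂−y₁y₂)`,
`z(ζ) = (1−y₂)^{−2}(1+h²+2h Re ζ)`, `(c,d)` the unique pair for `(a,b)` and `(γ,η)` the
analogous pair for `(α,β)`, the limit as `r → 1⁺` of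
`−(1/(2π²)) ∮_{|ζ₂|=1} ∮_{|ζ₁|=1} log(a+b z(ζ₁)) log(α+β z(ζ₂)) (ζ₁−rζ₂)^{−2} dζ₁ dζ₂`
equals `2 log(cγ/(cγ−dη))`. -/
theorem stmt2 (y₁ y₂ : ℝ) (hy₁ : y₁ ∈ Set.Ioo (0 : ℝ) 1) (hy₂ : y₂ ∈ Set.Ioo (0 : ℝ) 1)
    (a b α β : ℝ) (ha : 0 < a) (hb : 0 < b) (hα : 0 < α) (hβ : 0 < β)
    (h c d γ η : ℝ)
    (hh : h = Real.sqrt (y₁ + y₂ - y₁ * y₂))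
    (hd0 : 0 < d) (hdc : d < c)
    (hcd1 : c ^ 2 + d ^ 2 = a + b * (1 + h ^ 2) / (1 - y₂) ^ 2)
    (hcd2 : c * d = b * h / (1 - y₂) ^ 2)
    (hη0 : 0 < η) (hηγ : η < γ)
    (hγη1 : γ ^ 2 + η ^ 2 = α + β * (1 + h ^ 2) / (1 - y₂) ^ 2)
    (hγη2 : γ * η = β * h / (1 - y₂) ^ 2) :
    Tendsto
      (fun r : ℝ =>
        -(1 / (2 * (π : ℂ) ^ 2)) *
          ∮ ζ₂ in C(0, 1), ∮ ζ₁ in C(0, 1),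
            Complex.log ((a : ℂ) + (b : ℂ) * (((1 - y₂) ^ 2)⁻¹ * (1 + h ^ 2 + 2 * h * ζ₁.re) : ℝ)) *
              Complex.log ((α : ℂ) + (β : ℂ) * (((1 - y₂) ^ 2)⁻¹ * (1 + h ^ 2 + 2 * h * ζ₂.re) : ℝ)) *
                ((ζ₁ - (r : ℂ) * ζ₂) ^ 2)⁻¹)
      (nhdsWithin 1 (Set.Ioi 1))
      (nhds ((2 * Real.log (c * γ / (c * γ - d * η)) : ℝ) : ℂ)) := by
  have hc : 0 < c := hd0.trans hdc
  have hγ : 0 < γ := hη0.trans hηγ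
  have hq0 : 0 < d / c := by positivity
  have hq1 : d / c < 1 := (div_lt_one hc).2 hdc
  have hp0 : 0 < η / γ := by positivity
  have hp1 : η / γ < 1 := (div_lt_one hγ).2 hηγ
  have L1 : ∀ ζ ∈ Metric.sphere (0 : ℂ) 1,
      Complex.log ((a : ℂ) + (b : ℂ) * (((1 - y₂) ^ 2)⁻¹ * (1 + h ^ 2 + 2 * h * ζ.re) : ℝ)) =
      ((2 * Real.log c : ℝ) : ℂ)
      + Complex.log (1 + ((d / c : ℝ) : ℂ) * ζ) + Complex.log (1 + ((d / c : ℝ) : ℂ) * ζ⁻¹) := by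
    intro ζ hζ
    rw [← log_split hd0 hdc (by simpa using hζ)
      (a + b * (((1 - y₂) ^ 2)⁻¹ * (1 + h ^ 2 + 2 * h * ζ.re))) (by rw [hcd1, hcd2]; ring)]
    push_cast
    rfl
  have L2 : ∀ ζ ∈ Metric.sphere (0 : ℂ) 1,
      Complex.log ((α : ℂ) + (β : ℂ) * (((1 - y₂) ^ 2)⁻¹ * (1 + h ^ 2 + 2 * h * ζ.re) : ℝ)) =
      ((2 * Real.log γ : ℝ) : ℂ)
      + Complex.log (1 + ((η / γ : ℝ) : ℂ) * ζ) + Complex.log (1 + ((η / γ : ℝ) : ℂ) * ζ⁻¹) := by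
    intro ζ hζ
    rw [← log_split hη0 hηγ (by simpa using hζ)
      (α + β * (((1 - y₂) ^ 2)⁻¹ * (1 + h ^ 2 + 2 * h * ζ.re))) (by rw [hγη1, hγη2]; ring)]
    push_cast
    rfl
  have hpos : 0 < 1 - η / γ * (d / c) / 1 := by
    have : η / γ * (d / c) < 1 := by nlinarith
    rw [div_one]; linarith
  have hlim : Tendsto (fun r : ℝ => ((-2 * (r⁻¹ * Real.log (1 - η / γ * (d / c) / r)) : ℝ) : ℂ))
      (nhdsWithin 1 (Set.Ioi 1)) (nhds ((2 * Real.log (c * γ / (c * γ - d * η)) : ℝ) : ℂ)) := by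
    have hcont : ContinuousAt (fun r : ℝ => -2 * (r⁻¹ * Real.log (1 - η / γ * (d / c) / r))) 1 := by
      refine continuousAt_const.mul ((continuousAt_inv₀ one_ne_zero).mul ?_)
      refine ContinuousAt.log ?_ hpos.ne'
      exact continuousAt_const.sub (continuousAt_const.div continuousAt_id one_ne_zero)
    have hv : 2 * Real.log (c * γ / (c * γ - d * η)) =
        -2 * ((1 : ℝ)⁻¹ * Real.log (1 - η / γ * (d / c) / 1)) := by
      have : c * γ / (c * γ - d * η) = (1 - η / γ * (d / c) / 1)⁻¹ := by
        rw [← one_div_div, one_div]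
        congr 1
        field_simp
      rw [this, Real.log_inv]; ring
    rw [hv]
    exact (Complex.continuous_ofReal.continuousAt.tendsto.comp hcont.tendsto).mono_left
      nhdsWithin_le_nhds
  refine hlim.congr' ?_
  filter_upwards [self_mem_nhdsWithin] with r hr
  have hr1 : 1 < r := hr
  have hmain : (∮ ζ₂ in C(0, 1), ∮ ζ₁ in C(0, 1),
            Complex.log ((a : ℂ) + (b : ℂ) * (((1 - y₂) ^ 2)⁻¹ * (1 + h ^ 2 + 2 * h * ζ₁.re) : ℝ)) *
              Complex.log ((α : ℂ) + (β : ℂ) * (((1 - y₂) ^ 2)⁻¹ * (1 + h ^ 2 + 2 * h * ζ₂.re) : ℝ)) *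
                ((ζ₁ - (r : ℂ) * ζ₂) ^ 2)⁻¹)
      = ∮ ζ₂ in C(0, 1), (2 * π * Complex.I) * ((((2 * Real.log γ : ℝ) : ℂ)
      + Complex.log (1 + ((η / γ : ℝ) : ℂ) * ζ₂) + Complex.log (1 + ((η / γ : ℝ) : ℂ) * ζ₂⁻¹)) *
       (((d / c : ℝ) : ℂ) / ((r * ζ₂) * (r * ζ₂ + ((d / c : ℝ) : ℂ))))) := by
    refine circleIntegral.integral_congr zero_le_one fun ζ₂ hζ₂ => ?_
    have hn : ‖ζ₂‖ = 1 := by simpa using hζ₂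
    have hw : 1 < ‖(r : ℂ) * ζ₂‖ := by
      rw [norm_mul, hn, Complex.norm_real, Real.norm_of_nonneg (by linarith)]; linarith
    have hin := inner_int hq0 hq1 ((2 * Real.log c : ℝ) : ℂ) ((r : ℂ) * ζ₂) hw
    rw [← L2 ζ₂ hζ₂, mul_left_comm, ← hin, ← circleIntegral.integral_const_mul]
    refine circleIntegral.integral_congr zero_le_one fun ζ₁ hζ₁ => ?_
    rw [L1 ζ₁ hζ₁]
    ring
  rw [hmain, circleIntegral.integral_const_mul, outer_int hp0 hp1 hq0 hq1 hr1]
  have hpi : (π : ℂ) ≠ 0 := by exact_mod_cast Real.pi_ne_zero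
  push_cast
  field_simp
  rw [Complex.I_sq]
  ring
end

section
/- Let c = (1/2)(√(1 + (y₂/y₁)b₀) + √(1 + (y₂/y₁)a₀)) and d = (1/2)(√(1 + (y₂/y₁)b₀) − √(1 + (y₂/y₁)a₀)). Then ∫_{a₀}^{b₀} log(1 + (y₂/y₁)x) · (1−y₂)√((b₀−x)(x−a₀)) / (2π x (y₁ + y₂x)) dx = ((y₂−1)/y₂)·log c + ((y₁−1)/y₁)·log(c − dh) + ((y₁+y₂)/(y₁y₂))·log((ch − dy₂)/h). -/
open Real

lemma aux_pi (F : ℝ → ℝ) (hF : Continuous fun t => F (cos t)) :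
    ∫ t in (0:ℝ)..(2*π), F (cos t) = 2 * ∫ t in (0:ℝ)..π, F (cos t) := by
  rw [← intervalIntegral.integral_add_adjacent_intervals (b := π)
    (hF.intervalIntegrable _ _) (hF.intervalIntegrable _ _)]
  have : ∫ t in π..(2*π), F (cos t) = ∫ t in (0:ℝ)..π, F (cos t) := by
    have h := intervalIntegral.integral_comp_sub_left (a := 0) (b := π)
      (fun t => F (cos t)) (2*π)
    simp only [cos_two_pi_sub] at h
    rw [h]; congr 1 <;> ring
  rw [this]; ring

lemma aux_pos (c d t : ℝ) (hd : 0 ≤ d) (hdc : d < c) : 0 < c^2 + d^2 + 2*c*d*cos t := by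
  have h1 := neg_one_le_cos t
  have : 0 ≤ c * d * (1 + cos t) := by
    apply mul_nonneg (mul_nonneg (by linarith) hd) (by linarith)
  nlinarith [sq_pos_of_pos (sub_pos.2 hdc)]

lemma aux_norm (c d t : ℝ) : ‖(c:ℂ) + d * circleMap 0 1 t‖ ^ 2 = c^2 + d^2 + 2*c*d*cos t := by
  rw [← Complex.normSq_eq_norm_sq, Complex.normSq_apply]
  simp [circleMap, Complex.exp_re, Complex.exp_im]
  linear_combination d^2 * sin_sq_add_cos_sq t

lemma aux_poisson (c d p : ℝ) (hd : 0 ≤ d) (hdc : d < c) (hp : 0 ≤ p) (hp1 : p < 1) :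
    ∫ t in (0:ℝ)..π, log (c^2 + d^2 + 2*c*d*cos t) * ((1 - p^2) / (1^2 + p^2 + 2*1*p*cos t))
      = 2 * π * log (c - d * p) := by
  have hne : ∀ z : ℂ, ‖z‖ ≤ 1 → (c:ℂ) + d * z ≠ 0 := by
    intro z hz h0
    have h1 : (c:ℂ) = - (d * z) := by linear_combination h0
    have h2 : ‖(c:ℂ)‖ = ‖-((d:ℂ) * z)‖ := by rw [h1]
    rw [norm_neg, norm_mul, Complex.norm_real, Complex.norm_real, norm_of_nonneg hd,
      norm_of_nonneg (by linarith : 0 ≤ c)] at h2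
    nlinarith
  have hH : InnerProductSpace.HarmonicOnNhd (fun z : ℂ => log ‖(c:ℂ) + d * z‖)
      (Metric.closedBall 0 1) := by
    intro z hz
    exact AnalyticAt.harmonicAt_log_norm (f := fun z : ℂ => (c:ℂ) + d * z) (by fun_prop)
      (hne z (by simpa using hz))
  have key := hH.circleAverage_poissonKernel_smul (w := ((-p : ℝ) : ℂ))
    (by simp [abs_of_nonneg hp, hp1])
  have e : (fun t : ℝ => (poissonKernel 0 ((-p : ℝ) : ℂ) • fun z : ℂ => log ‖(c:ℂ) + d * z‖)
      (circleMap 0 1 t)) = fun t => (1/2) * (log (c^2 + d^2 + 2*c*d*cos t) *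
        ((1 - p^2) / (1^2 + p^2 + 2*1*p*cos t))) := by
    funext t
    have h1 := aux_norm c d t
    have h2 := aux_norm 1 p t
    have h4 := aux_norm p 1 t
    have h3 : circleMap 0 1 t - 0 - (((-p : ℝ) : ℂ) - 0) = (p:ℂ) + (1:ℝ) * circleMap 0 1 t := by
      push_cast; ring
    simp only [Pi.smul_apply', poissonKernel, smul_eq_mul]
    rw [h3, h4, ← h1, log_pow]
    simp
    ring
  rw [Real.circleAverage_def, e, intervalIntegral.integral_const_mul,
    aux_pi (fun x => log (c^2 + d^2 + 2*c*d*x) * ((1 - p^2) / (1^2 + p^2 + 2*1*p*x)))] at key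
  · have h5 : ‖(c:ℂ) + d * ((-p : ℝ) : ℂ)‖ = c - d * p := by
      rw [show (c:ℂ) + d * ((-p : ℝ) : ℂ) = ((c - d * p : ℝ) : ℂ) by push_cast; ring,
        Complex.norm_real, norm_of_nonneg]
      nlinarith
    rw [h5, smul_eq_mul] at key
    have := pi_pos
    generalize (∫ t in (0:ℝ)..π, log (c^2 + d^2 + 2*c*d*cos t) *
      ((1 - p^2) / (1^2 + p^2 + 2*1*p*cos t))) = J at key ⊢
    rw [← key]
    field_simp
  · apply Continuous.mul
    · apply Continuous.log (by fun_prop)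
      intro t; exact (aux_pos c d t hd hdc).ne'
    · apply Continuous.div (by fun_prop) (by fun_prop)
      intro t; exact (aux_pos 1 p t hp hp1).ne'


lemma aux_alg (y₁ y₂ h C S : ℝ) (h2 : h^2 = y₁ + y₂ - y₁*y₂) (hS : S^2 + C^2 = 1) :
    4*h^2*S^2*(1-y₂)*y₁*y₂ = -(1-y₂)*y₁*(1^2+h^2+2*1*h*C)*(h^2+y₂^2+2*h*y₂*C)
      + y₂*(y₁-1)*(1-h^2)*(h^2+y₂^2+2*h*y₂*C)
      + (y₁+y₂)*(h^2-y₂^2)*(1^2+h^2+2*1*h*C) := by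
  have hw : 4*h^2*S^2 = 4*h^2 - (2*h*C)^2 := by linear_combination 4*h^2*hS
  rw [hw, show 2*1*h*C = 2*h*C by ring, show 2*h*y₂*C = y₂*(2*h*C) by ring, h2]
  ring

/-- with `y₁, y₂ ∈ (0,1)`, `h = √(y₁+y₂−y₁y₂)`, `a₀ = (1−h)²/(1−y₂)²`,
`b₀ = (1+h)²/(1−y₂)²`, and `c, d` given by the displayed formulas,
`∫_{a₀}^{b₀} log(1+(y₂/y₁)x) (1−y₂)√((b₀−x)(x−a₀))/(2πx(y₁+y₂x)) dx`
equals `((y₂−1)/y₂) log c + ((y₁−1)/y₁) log(c−dh) + ((y₁+y₂)/(y₁y₂)) log((ch−dy₂)/h)`. -/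
theorem stmt3 (y₁ y₂ : ℝ) (hy₁ : y₁ ∈ Set.Ioo (0 : ℝ) 1) (hy₂ : y₂ ∈ Set.Ioo (0 : ℝ) 1)
    (h a₀ b₀ c d : ℝ)
    (hh : h = Real.sqrt (y₁ + y₂ - y₁ * y₂))
    (ha₀ : a₀ = (1 - h) ^ 2 / (1 - y₂) ^ 2)
    (hb₀ : b₀ = (1 + h) ^ 2 / (1 - y₂) ^ 2)
    (hc : c = (1 / 2) * (Real.sqrt (1 + (y₂ / y₁) * b₀) + Real.sqrt (1 + (y₂ / y₁) * a₀)))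
    (hd : d = (1 / 2) * (Real.sqrt (1 + (y₂ / y₁) * b₀) - Real.sqrt (1 + (y₂ / y₁) * a₀))) :
    ∫ x in a₀..b₀,
        Real.log (1 + (y₂ / y₁) * x) *
          ((1 - y₂) * Real.sqrt ((b₀ - x) * (x - a₀))) / (2 * π * x * (y₁ + y₂ * x)) =
      ((y₂ - 1) / y₂) * Real.log c + ((y₁ - 1) / y₁) * Real.log (c - d * h) +
        ((y₁ + y₂) / (y₁ * y₂)) * Real.log ((c * h - d * y₂) / h) := by
  obtain ⟨h10, h11⟩ := hy₁
  obtain ⟨h20, h21⟩ := hy₂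
  have hpi := pi_pos
  have hs : 0 < 1 - y₂ := by linarith
  have hpos : 0 < y₁ + y₂ - y₁ * y₂ := by nlinarith
  have hh0 : 0 < h := by rw [hh]; exact sqrt_pos.2 hpos
  have h2 : h^2 = y₁ + y₂ - y₁*y₂ := by rw [hh, sq_sqrt hpos.le]
  have hh1 : h < 1 := by nlinarith [mul_pos (sub_pos.2 h11) hs]
  have hyh : y₂ < h := by nlinarith [mul_pos h10 hs, mul_pos h20 hs]
  obtain ⟨q, hq0, hq⟩ : ∃ q : ℝ, 0 < q ∧ q^2 = y₁ := ⟨√y₁, sqrt_pos.2 h10, sq_sqrt h10.le⟩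
  have hb : √(1 + (y₂ / y₁) * b₀) = (h + y₂) / (q * (1 - y₂)) := by
    rw [show 1 + (y₂ / y₁) * b₀ = ((h + y₂) / (q * (1 - y₂)))^2 by
      rw [hb₀, div_pow, mul_pow, hq]; field_simp
      linear_combination (y₂-1) * h2]
    exact sqrt_sq (by positivity)
  have ha : √(1 + (y₂ / y₁) * a₀) = (h - y₂) / (q * (1 - y₂)) := by
    rw [show 1 + (y₂ / y₁) * a₀ = ((h - y₂) / (q * (1 - y₂)))^2 by
      rw [ha₀, div_pow, mul_pow, hq]; field_simp
      linear_combination (y₂-1) * h2]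
    exact sqrt_sq (div_nonneg (by linarith) (by positivity))
  have hc' : c = h / (q * (1 - y₂)) := by rw [hc, ha, hb]; ring
  have hd' : d = y₂ / (q * (1 - y₂)) := by rw [hd, ha, hb]; ring
  have hd0 : 0 ≤ d := by rw [hd']; positivity
  have hdc : d < c := by rw [hc', hd']; gcongr
  clear hc hd ha hb hh
  have hr0 : 0 ≤ y₂ / h := by positivity
  have hr1 : y₂ / h < 1 := (div_lt_one hh0).2 hyh
  have I0 := aux_poisson c d 0 hd0 hdc le_rfl one_pos
  have I1 := aux_poisson c d h hd0 hdc hh0.le hh1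
  have I2 := aux_poisson c d (y₂/h) hd0 hdc hr0 hr1
  have cont : ∀ p : ℝ, 0 ≤ p → p < 1 → Continuous fun t =>
      log (c^2 + d^2 + 2*c*d*cos t) * ((1 - p^2) / (1^2 + p^2 + 2*1*p*cos t)) := by
    intro p hp hp1
    apply Continuous.mul
    · apply Continuous.log (by fun_prop)
      intro t; exact (aux_pos c d t hd0 hdc).ne'
    · apply Continuous.div (by fun_prop) (by fun_prop)
      intro t; exact (aux_pos 1 p t hp hp1).ne'
  have sub := intervalIntegral.integral_comp_mul_deriv_of_deriv_nonpos (a := 0) (b := π)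
    (f := fun t => (1 + h^2 + 2*h*cos t) / (1 - y₂)^2)
    (f' := fun t => (2*h*(-sin t)) / (1 - y₂)^2)
    (g := fun x => Real.log (1 + (y₂ / y₁) * x) *
          ((1 - y₂) * Real.sqrt ((b₀ - x) * (x - a₀))) / (2 * π * x * (y₁ + y₂ * x)))
    (by fun_prop)
    (by
      intro t _
      exact (((hasDerivAt_cos t).const_mul (2*h)).const_add (1+h^2)).div_const _)
    (by
      intro t ht
      rw [min_eq_left hpi.le, max_eq_right hpi.le] at ht
      have := sin_pos_of_pos_of_lt_pi ht.1 ht.2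
      apply div_nonpos_of_nonpos_of_nonneg _ (by positivity)
      have := mul_pos hh0 this
      linarith)
  have e0 : (1 + h^2 + 2*h*cos 0) / (1 - y₂)^2 = b₀ := by rw [hb₀, cos_zero]; ring
  have e1 : (1 + h^2 + 2*h*cos π) / (1 - y₂)^2 = a₀ := by rw [ha₀, cos_pi]; ring
  simp only [e0, e1] at sub
  rw [intervalIntegral.integral_symm, ← sub]
  have main : ∀ t ∈ Set.uIcc 0 π, (((fun x => Real.log (1 + (y₂ / y₁) * x) *
          ((1 - y₂) * Real.sqrt ((b₀ - x) * (x - a₀))) / (2 * π * x * (y₁ + y₂ * x))) ∘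
          fun t => (1 + h^2 + 2*h*cos t) / (1 - y₂)^2) t * ((2*h*(-sin t)) / (1 - y₂)^2)) =
      (((1 - y₂) / (2*π*y₂)) * (log (c^2 + d^2 + 2*c*d*cos t) *
          ((1 - 0^2) / (1^2 + 0^2 + 2*1*0*cos t)))
       + (-((y₁-1) / (2*π*y₁))) * (log (c^2 + d^2 + 2*c*d*cos t) *
          ((1 - h^2) / (1^2 + h^2 + 2*1*h*cos t))))
       + (-((y₁+y₂) / (2*π*(y₁*y₂)))) * (log (c^2 + d^2 + 2*c*d*cos t) *
          ((1 - (y₂/h)^2) / (1^2 + (y₂/h)^2 + 2*1*(y₂/h)*cos t))) := by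
    intro t ht
    rw [Set.uIcc_of_le hpi.le] at ht
    have hsin := sin_nonneg_of_nonneg_of_le_pi ht.1 ht.2
    have hsc := sin_sq_add_cos_sq t
    have hu := aux_pos 1 h t hh0.le hh1
    have hv := aux_pos h y₂ t h20.le hyh
    have alg := aux_alg y₁ y₂ h (cos t) (sin t) h2 hsc
    have hsq : √((b₀ - (1 + h^2 + 2*h*cos t) / (1 - y₂)^2) *
        ((1 + h^2 + 2*h*cos t) / (1 - y₂)^2 - a₀)) = 2*h*sin t / (1 - y₂)^2 := by
      rw [show (b₀ - (1 + h^2 + 2*h*cos t) / (1 - y₂)^2) *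
        ((1 + h^2 + 2*h*cos t) / (1 - y₂)^2 - a₀) = (2*h*sin t / (1 - y₂)^2)^2 by
          rw [hb₀, ha₀]; field_simp
          linear_combination -4*h^2*hsc]
      exact sqrt_sq (by positivity)
    have hv2 : y₁ + y₂ * ((1 + h^2 + 2*h*cos t) / (1 - y₂)^2)
        = (h^2 + y₂^2 + 2*h*y₂*cos t) / (1 - y₂)^2 := by
      field_simp
      linear_combination (y₂-1) * h2
    have hlog : 1 + (y₂ / y₁) * ((1 + h^2 + 2*h*cos t) / (1 - y₂)^2)
        = c^2 + d^2 + 2*c*d*cos t := by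
      have : c^2 + d^2 + 2*c*d*cos t = (h^2 + y₂^2 + 2*h*y₂*cos t) / (1 - y₂)^2 / y₁ := by
        rw [hc', hd', ← hq]; field_simp
      rw [this, ← hv2]; field_simp
    have hr : (1 - (y₂/h)^2) / (1^2 + (y₂/h)^2 + 2*1*(y₂/h)*cos t)
        = (h^2 - y₂^2) / (h^2 + y₂^2 + 2*h*y₂*cos t) := by
      have : 1^2 + (y₂/h)^2 + 2*1*(y₂/h)*cos t = (h^2 + y₂^2 + 2*h*y₂*cos t) / h^2 := by
        field_simp
      rw [this]; field_simp
    simp only [Function.comp]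
    rw [hsq, hv2, hlog, hr]
    generalize log (c^2 + d^2 + 2*c*d*cos t) = L
    rw [show 1 + h^2 + 2*h*cos t = 1^2 + h^2 + 2*1*h*cos t by ring]
    rw [show (1:ℝ)^2 + 0^2 + 2*1*0*cos t = 1 by ring]
    generalize 1^2 + h^2 + 2*1*h*cos t = u at *
    generalize h^2 + y₂^2 + 2*h*y₂*cos t = v at *
    have hne := hu.ne'
    have hne' := hv.ne'
    field_simp
    linear_combination (-L) * alg
  rw [intervalIntegral.integral_congr main, intervalIntegral.integral_add,
    intervalIntegral.integral_add, intervalIntegral.integral_const_mul,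
    intervalIntegral.integral_const_mul, intervalIntegral.integral_const_mul, I0, I1, I2]
  · rw [show (c * h - d * y₂) / h = c - d * (y₂/h) by field_simp, mul_zero, sub_zero]
    field_simp
    ring
  · exact ((cont 0 le_rfl one_pos).const_mul _).intervalIntegrable _ _
  · exact ((cont h hh0.le hh1).const_mul _).intervalIntegrable _ _
  · exact (((cont 0 le_rfl one_pos).const_mul _).add
      ((cont h hh0.le hh1).const_mul _)).intervalIntegrable _ _
  · exact ((cont _ hr0 hr1).const_mul _).intervalIntegrable _ _
end

section
/- The function ℓ(x) = (1−y₂)√((b₀−x)(x−a₀)) / (2π x (y₁ + y₂x)) for a₀ ≤ x ≤ b₀, and ℓ(x) = 0 otherwise, is a probability density: ℓ is nonnegative and ∫_{a₀}^{b₀} ℓ(x) dx = 1. -/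
open Real

lemma aux_deriv (a b x : ℝ) (ha : 0 < a) (hx : x ∈ Set.Ioo a b) :
    HasDerivAt (fun x => √((b - x) * (x - a)) + (a + b) / 2 * arcsin ((2 * x - a - b) / (b - a))
      - √(a * b) * arcsin (((a + b) - 2 * a * b / x) / (b - a)))
      (√((b - x) * (x - a)) / x) x := by
  obtain ⟨h1, h2⟩ := hx
  have hx0 : 0 < x := ha.trans h1
  have hb : 0 < b := hx0.trans h2
  have hd : 0 < b - a := by linarith
  have hP : 0 < (b - x) * (x - a) := mul_pos (by linarith) (by linarith)
  have hab : 0 < a * b := mul_pos ha hb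
  have hR : 0 < √((b - x) * (x - a)) := Real.sqrt_pos.2 hP
  have hS : 0 < √(a * b) := Real.sqrt_pos.2 hab
  have hR2 : √((b - x) * (x - a)) ^ 2 = (b - x) * (x - a) := Real.sq_sqrt hP.le
  have hS2 : √(a * b) ^ 2 = a * b := Real.sq_sqrt hab.le
  have d1 : HasDerivAt (fun x => √((b - x) * (x - a)))
      (((-1) * (x - a) + (b - x) * 1) / (2 * √((b - x) * (x - a)))) x :=
    (((hasDerivAt_id x).const_sub b).mul ((hasDerivAt_id x).sub_const a)).sqrt hP.ne'
  have d2 : HasDerivAt (fun x => (2 * x - a - b) / (b - a)) (2 * 1 / (b - a)) x :=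
    (((((hasDerivAt_id x).const_mul 2).sub_const a).sub_const b).div_const _)
  have d3 : HasDerivAt (fun x => ((a + b) - 2 * a * b / x) / (b - a))
      ((2 * a * b / x ^ 2) / (b - a)) x := by
    have := (((hasDerivAt_inv hx0.ne').const_mul (2 * a * b)).const_sub (a + b)).div_const (b - a)
    refine this.congr_deriv ?_
    field_simp
  have q2 : 1 - ((2 * x - a - b) / (b - a)) ^ 2 = (2 * √((b - x) * (x - a)) / (b - a)) ^ 2 := by
    rw [div_pow, div_pow, mul_pow, hR2]
    field_simp
    ring
  have q3 : 1 - (((a + b) - 2 * a * b / x) / (b - a)) ^ 2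
      = (2 * √(a * b) * √((b - x) * (x - a)) / (x * (b - a))) ^ 2 := by
    rw [div_pow, div_pow, mul_pow, mul_pow, hR2, hS2]
    field_simp
    ring
  have p2 : 0 < 1 - ((2 * x - a - b) / (b - a)) ^ 2 := by rw [q2]; positivity
  have p3 : 0 < 1 - (((a + b) - 2 * a * b / x) / (b - a)) ^ 2 := by rw [q3]; positivity
  have e2 := (Real.hasDerivAt_arcsin (by rintro h; rw [h] at p2; norm_num at p2)
    (by rintro h; rw [h] at p2; norm_num at p2)).comp x d2
  have e3 := (Real.hasDerivAt_arcsin (by rintro h; rw [h] at p3; norm_num at p3)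
    (by rintro h; rw [h] at p3; norm_num at p3)).comp x d3
  rw [q2, Real.sqrt_sq (by positivity)] at e2
  rw [q3, Real.sqrt_sq (by positivity)] at e3
  have := (d1.add (e2.const_mul ((a + b) / 2))).sub (e3.const_mul (√(a * b)))
  refine this.congr_deriv ?_
  field_simp
  rw [mul_comm (x - a) (b - x), hR2]
  ring

lemma aux_int_s4 (a b : ℝ) (ha : 0 < a) (hab : a < b) :
    ∫ x in a..b, √((b - x) * (x - a)) / x = π * ((a + b) / 2 - √(a * b)) := by
  have hb := ha.trans hab
  have hd : b - a ≠ 0 := by linarith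
  have hne : ∀ x ∈ Set.Icc a b, x ≠ 0 := fun x hx => (ha.trans_le hx.1).ne'
  rw [intervalIntegral.integral_eq_sub_of_hasDerivAt_of_le hab.le (f := fun x =>
    √((b - x) * (x - a)) + (a + b) / 2 * arcsin ((2 * x - a - b) / (b - a))
      - √(a * b) * arcsin (((a + b) - 2 * a * b / x) / (b - a))) ?_
      (fun x hx => aux_deriv a b x ha hx) ?_]
  · have h1 : (2 * b - a - b) / (b - a) = 1 := by field_simp; ring
    have h2 : (2 * a - a - b) / (b - a) = -1 := by field_simp; ring
    have h3 : ((a + b) - 2 * a * b / b) / (b - a) = 1 := by field_simp; ring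
    have h4 : ((a + b) - 2 * a * b / a) / (b - a) = -1 := by field_simp; ring
    simp only [h1, h2, h3, h4, Real.arcsin_one, Real.arcsin_neg_one, sub_self, mul_zero, zero_mul,
      Real.sqrt_zero]
    ring
  · have : ContinuousOn (fun x : ℝ => 2 * a * b / x) (Set.Icc a b) :=
      continuousOn_const.div continuousOn_id hne
    refine ContinuousOn.sub (by fun_prop) (continuousOn_const.mul ?_)
    exact Real.continuous_arcsin.comp_continuousOn ((continuousOn_const.sub this).div_const _)
  · apply ContinuousOn.intervalIntegrable
    rw [Set.uIcc_of_le hab.le]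
    exact ContinuousOn.div (by fun_prop) continuousOn_id hne

lemma aux_shift (a b c : ℝ) (ha : 0 < a + c) (hab : a < b) :
    ∫ x in a..b, √((b - x) * (x - a)) / (x + c)
      = π * ((a + b) / 2 + c - √((a + c) * (b + c))) := by
  have := intervalIntegral.integral_comp_add_right (a := a) (b := b)
    (fun x => √((b + c - x) * (x - (a + c))) / x) c
  rw [aux_int_s4 (a + c) (b + c) ha (by linarith)] at this
  simp only [add_sub_add_right_eq_sub] at this
  rw [this]
  ring

/-- with `y₁, y₂ ∈ (0,1)`, `h = √(y₁+y₂−y₁y₂)`, `a₀ = (1−h)²/(1−y₂)²`,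
`b₀ = (1+h)²/(1−y₂)²`, the function
`ℓ(x) = (1−y₂)√((b₀−x)(x−a₀))/(2πx(y₁+y₂x))` on `[a₀, b₀]` (and `0` elsewhere)
is a probability density: it is nonnegative and `∫_{a₀}^{b₀} ℓ(x) dx = 1`. -/
theorem stmt4 (y₁ y₂ : ℝ) (hy₁ : y₁ ∈ Set.Ioo (0 : ℝ) 1) (hy₂ : y₂ ∈ Set.Ioo (0 : ℝ) 1)
    (h a₀ b₀ : ℝ)
    (hh : h = Real.sqrt (y₁ + y₂ - y₁ * y₂))
    (ha₀ : a₀ = (1 - h) ^ 2 / (1 - y₂) ^ 2)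
    (hb₀ : b₀ = (1 + h) ^ 2 / (1 - y₂) ^ 2)
    (ℓ : ℝ → ℝ)
    (hℓ : ∀ x : ℝ, ℓ x =
      if x ∈ Set.Icc a₀ b₀ then
        (1 - y₂) * Real.sqrt ((b₀ - x) * (x - a₀)) / (2 * π * x * (y₁ + y₂ * x))
      else 0) :
    (∀ x : ℝ, 0 ≤ ℓ x) ∧ ∫ x in a₀..b₀, ℓ x = 1 := by
  obtain ⟨h10, h11⟩ := hy₁
  obtain ⟨h20, h21⟩ := hy₂
  have hq : 0 < y₁ + y₂ - y₁ * y₂ := by nlinarith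
  have hpos : 0 < h := hh ▸ Real.sqrt_pos.2 hq
  have hsq : h ^ 2 = y₁ + y₂ - y₁ * y₂ := hh ▸ Real.sq_sqrt hq.le
  have hlt : h < 1 := by nlinarith
  have hz : 0 < 1 - y₂ := by linarith
  have ha : 0 < a₀ := by
    rw [ha₀]
    have : 0 < 1 - h := by linarith
    positivity
  have hab : a₀ < b₀ := by
    rw [ha₀, hb₀]
    apply div_lt_div_of_pos_right _ (by positivity)
    nlinarith
  refine ⟨fun x => ?_, ?_⟩
  · rw [hℓ]
    split_ifs with hx
    · have : 0 < x := ha.trans_le hx.1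
      positivity
    · exact le_rfl
  have hc : 0 < y₁ / y₂ := by positivity
  have hprod : a₀ * b₀ = ((1 - y₁) / (1 - y₂)) ^ 2 := by
    have : a₀ * b₀ = (1 - h ^ 2) ^ 2 / (1 - y₂) ^ 4 := by
      rw [ha₀, hb₀]; field_simp; ring
    rw [this, hsq]; field_simp; ring
  have hsum : a₀ + b₀ = 2 * (1 + y₁ + y₂ - y₁ * y₂) / (1 - y₂) ^ 2 := by
    have : a₀ + b₀ = 2 * (1 + h ^ 2) / (1 - y₂) ^ 2 := by
      rw [ha₀, hb₀]; field_simp; ring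
    rw [this, hsq]; ring
  have hprod2 : (a₀ + y₁ / y₂) * (b₀ + y₁ / y₂) = ((1 + y₁) / (1 - y₂) + y₁ / y₂) ^ 2 := by
    have : (a₀ + y₁ / y₂) * (b₀ + y₁ / y₂)
      = a₀ * b₀ + (y₁ / y₂) * (a₀ + b₀) + (y₁ / y₂) ^ 2 := by ring
    rw [this, hprod, hsum]; field_simp; ring
  have s1 : √((a₀ + 0) * (b₀ + 0)) = (1 - y₁) / (1 - y₂) := by
    rw [add_zero, add_zero, hprod, Real.sqrt_sq (div_nonneg (by linarith) hz.le)]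
  have s2 : √((a₀ + y₁ / y₂) * (b₀ + y₁ / y₂)) = (1 + y₁) / (1 - y₂) + y₁ / y₂ := by
    rw [hprod2, Real.sqrt_sq (by positivity)]
  have i1 := aux_shift a₀ b₀ 0 (by linarith) hab
  have i2 := aux_shift a₀ b₀ (y₁ / y₂) (by linarith) hab
  rw [s1] at i1
  rw [s2] at i2
  have hint : ∀ c : ℝ, 0 ≤ c → IntervalIntegrable
      (fun x => √((b₀ - x) * (x - a₀)) / (x + c)) MeasureTheory.volume a₀ b₀ := by
    intro c hc
    apply ContinuousOn.intervalIntegrable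
    rw [Set.uIcc_of_le hab.le]
    refine ContinuousOn.div (by fun_prop) (by fun_prop) fun x hx => ?_
    have := ha.trans_le hx.1
    positivity
  have key : ∫ x in a₀..b₀, ℓ x = ∫ x in a₀..b₀, (1 - y₂) / (2 * π * y₁) *
      (√((b₀ - x) * (x - a₀)) / (x + 0) - √((b₀ - x) * (x - a₀)) / (x + y₁ / y₂)) := by
    apply intervalIntegral.integral_congr
    intro x hx
    rw [Set.uIcc_of_le hab.le] at hx
    have hx0 := ha.trans_le hx.1
    have h3 : 0 < y₁ + y₂ * x := by positivity
    have h4 : x + y₁ / y₂ = (y₁ + y₂ * x) / y₂ := by field_simp; ring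
    have hpi := Real.pi_pos
    simp only [hℓ, if_pos hx, h4, add_zero]
    field_simp
    ring
  rw [key, intervalIntegral.integral_const_mul,
    intervalIntegral.integral_sub (hint 0 le_rfl) (hint _ hc.le), i1, i2]
  have hpi := Real.pi_pos
  field_simp
  ring
end

section
/- Consider a sequence of multivariate linear regression models indexed by n: x_i = B z_i + ε_i, i = 1,…,n, where x_i ∈ ℝ^p, the ε_i are i.i.d. N_p(0, Σ) with Σ positive definite, B is a p×q matrix of coefficients partitioned as B = (B₁, B₂) with q₁ and q₂ = q − q₁ columns, the z_i ∈ ℝ^q are known nonrandom regressors with Z = (z₁,…,z_n) of full rank q, and n ≥ p + q. Assume the null hypothesis H₀: B₁ = B₁* holds. Let Λ_n = det(Σ̂)/det(Σ̂₀) be Wilk's likelihood ratio statistic, where Σ̂ = (1/n)Σᵢ(x_i − B̂z_i)(x_i − B̂z_i)ᵀ with B̂ = (Σᵢ x_i z_iᵀ)(Σᵢ z_i z_iᵀ)^{−1}, and Σ̂₀ = (1/n)Σᵢ(y_i − B̂₂₀z_{i,2})(y_i − B̂₂₀z_{i,2})ᵀ with y_i = x_i − B₁* z_{i,1}, B̂₂₀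 = (Σᵢ y_i z_{i,2}ᵀ)(Σᵢ z_{i,2} z_{i,2}ᵀ)^{−1}, where z_iᵀ = (z_{i,1}ᵀ, z_{i,2}ᵀ) is the partition into the first q₁ and last q₂ coordinates. Suppose that as n → ∞: p → ∞, q₁ → ∞, n − q → ∞, y_{n₁} = p/q₁ → y₁ ∈ (0,1) and y_{n₂} = p/(n−q) → y₂ ∈ (0,1). Then T_n = v^{−1/2}·[ −log Λ_n − p·F_n − m ] converges in distribution to the standard normal law N(0,1), where m = (1/2)·log((c²−d²)h²/(ch − y₂d)²) and v = 2·log(c²/(c²−d²)) are computed from the limits y₁, y₂ via h = √(y₁+y₂−y₁y₂), a₀ = (1−h)²/(1−y₂)², b₀ = (1+h)²/(1−y₂)², c = (1/2)(√(1+(y₂/y₁)b₀)+√(1+(y₂/y₁)a₀)), d = (1/2)(√(1+(y₂/y₁)b₀)−√(1+(y₂/y₁)a₀)); and F_n = ((y_{n₂}−1)/y_{n₂})·log c_n + ((y_{n₁}−1)/y_{n₁})·log(c_n − d_n h_n) + ((y_{n₁}+y_{n₂})/(y_{n₁}y_{n₂}))·log((c_n h_n − d_n y_{n₂})/h_n),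 computed from the finite-n ratios via h_n = √(y_{n₁}+y_{n₂}−y_{n₁}y_{n₂}), a_n = (1−h_n)²/(1−y_{n₂})², b_n = (1+h_n)²/(1−y_{n₂})², c_n = (1/2)(√(1+(y_{n₂}/y_{n₁})b_n)+√(1+(y_{n₂}/y_{n₁})a_n)), d_n = (1/2)(√(1+(y_{n₂}/y_{n₁})b_n)−√(1+(y_{n₂}/y_{n₁})a_n)). -/
open Real Filter MeasureTheory ProbabilityTheory Matrix

noncomputable def fisherH (u₁ u₂ : ℝ) : ℝ := Real.sqrt (u₁ + u₂ - u₁ * u₂)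
noncomputable def fisherA (u₁ u₂ : ℝ) : ℝ := (1 - fisherH u₁ u₂) ^ 2 / (1 - u₂) ^ 2
noncomputable def fisherB (u₁ u₂ : ℝ) : ℝ := (1 + fisherH u₁ u₂) ^ 2 / (1 - u₂) ^ 2
/-- `c = (1/2)(√(1+(u₂/u₁)b₀)+√(1+(u₂/u₁)a₀))`. -/
noncomputable def fisherC (u₁ u₂ : ℝ) : ℝ :=
  (1 / 2) * (Real.sqrt (1 + (u₂ / u₁) * fisherB u₁ u₂) + Real.sqrt (1 + (u₂ / u₁) * fisherA u₁ u₂))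
/-- `d = (1/2)(√(1+(u₂/u₁)b₀)−√(1+(u₂/u₁)a₀))`. -/
noncomputable def fisherD (u₁ u₂ : ℝ) : ℝ :=
  (1 / 2) * (Real.sqrt (1 + (u₂ / u₁) * fisherB u₁ u₂) - Real.sqrt (1 + (u₂ / u₁) * fisherA u₁ u₂))
/-- `m = (1/2)·log((c²−d²)h²/(ch−u₂d)²)`. -/
noncomputable def wilksMean (u₁ u₂ : ℝ) : ℝ :=
  (1 / 2) * Real.log ((fisherC u₁ u₂ ^ 2 - fisherD u₁ u₂ ^ 2) * fisherH u₁ u₂ ^ 2 /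
      (fisherC u₁ u₂ * fisherH u₁ u₂ - u₂ * fisherD u₁ u₂) ^ 2)
/-- `v = 2·log(c²/(c²−d²))`. -/
noncomputable def wilksVar (u₁ u₂ : ℝ) : ℝ :=
  2 * Real.log (fisherC u₁ u₂ ^ 2 / (fisherC u₁ u₂ ^ 2 - fisherD u₁ u₂ ^ 2))
/-- `F = ((u₂−1)/u₂)·log c + ((u₁−1)/u₁)·log(c−dh) + ((u₁+u₂)/(u₁u₂))·log((ch−du₂)/h)`. -/
noncomputable def wilksF (u₁ u₂ : ℝ) : ℝ :=
  ((u₂ - 1) / u₂) * Real.log (fisherC u₁ u₂) +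
    ((u₁ - 1) / u₁) * Real.log (fisherC u₁ u₂ - fisherD u₁ u₂ * fisherH u₁ u₂) +
    ((u₁ + u₂) / (u₁ * u₂)) *
      Real.log ((fisherC u₁ u₂ * fisherH u₁ u₂ - fisherD u₁ u₂ * u₂) / fisherH u₁ u₂)


namespace Wilks

/-- standard Gaussian on functions -/
noncomputable def gam (S : Type*) [Fintype S] : Measure (S → ℝ) :=
  Measure.pi (fun _ : S => gaussianReal 0 1)

instance {S : Type*} [Fintype S] : IsProbabilityMeasure (gam S) := by
  unfold gam; infer_instance

lemma gam_density (S : Type*) [Fintype S] :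
    gam S = volume.withDensity
      (fun x : S → ℝ => ENNReal.ofReal (∏ i, gaussianPDFReal 0 1 (x i))) := by
  unfold gam
  refine Measure.pi_eq fun s hs => ?_
  rw [withDensity_apply _ (MeasurableSet.univ_pi hs)]
  have h1 : ∀ i, gaussianReal 0 1 (s i)
      = ENNReal.ofReal (∫ x, (s i).indicator (gaussianPDFReal 0 1) x) := by
    intro i
    rw [gaussianReal_apply_eq_integral _ one_ne_zero, integral_indicator (hs i)]
  simp_rw [h1]
  have hint : ∀ i, Integrable ((s i).indicator (gaussianPDFReal 0 1)) volume := fun i =>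
    (integrable_gaussianPDFReal 0 1).indicator (hs i)
  rw [← ENNReal.ofReal_prod_of_nonneg, ← integral_fintype_prod_volume_eq_prod,
    ofReal_integral_eq_lintegral_ofReal, ← lintegral_indicator (MeasurableSet.univ_pi hs)]
  · congr 1
    ext x
    by_cases hx : x ∈ Set.univ.pi s
    · rw [Set.indicator_of_mem hx]
      congr 1
      refine Finset.prod_congr rfl fun i _ => ?_
      rw [Set.indicator_of_mem (hx i (Set.mem_univ i))]
    · rw [Set.indicator_of_notMem hx]
      simp only [Set.mem_univ_pi, not_forall] at hx
      obtain ⟨i, hi⟩ := hx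
      rw [Finset.prod_eq_zero (Finset.mem_univ i), ENNReal.ofReal_zero]
      rw [Set.indicator_of_notMem hi]
  · exact Integrable.fintype_prod hint
  · refine Filter.Eventually.of_forall fun x => Finset.prod_nonneg fun i _ => ?_
    exact Set.indicator_nonneg (fun _ _ => gaussianPDFReal_nonneg _ _ _) _
  · exact fun i _ => integral_nonneg fun x =>
      Set.indicator_nonneg (fun _ _ => gaussianPDFReal_nonneg _ _ _) _

lemma integral_gam (S : Type*) [Fintype S] (f : (S → ℝ) → ℂ) :
    ∫ x, f x ∂(gam S) = ((√(2 * π))⁻¹ : ℂ) ^ Fintype.card S *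
      ∫ x : EuclideanSpace ℝ S, f (WithLp.ofLp x) * Complex.exp (-(‖x‖ : ℂ) ^ 2 / 2) := by
  rw [gam_density, integral_withDensity_eq_integral_toReal_smul]
  · rw [← (PiLp.volume_preserving_ofLp S).integral_comp
      (MeasurableEquiv.toLp 2 (S → ℝ)).symm.measurableEmbedding, ← integral_const_mul]
    congr 1
    ext x
    rw [ENNReal.toReal_ofReal (Finset.prod_nonneg fun i _ => gaussianPDFReal_nonneg _ _ _)]
    simp only [gaussianPDFReal, Complex.real_smul]
    rw [Finset.prod_mul_distrib, Finset.prod_const, ← Real.exp_sum, ← Complex.ofReal_pow,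
      EuclideanSpace.real_norm_sq_eq]
    simp [Finset.sum_div, neg_div]
    ring
  · fun_prop
  · simp

lemma polar {S : Type*} [Fintype S] [Nonempty S] (φ : EuclideanSpace ℝ S → ℂ)
    (hφ : ∀ (r : ℝ) x, 0 < r → φ (r • x) = φ x) (h : ℝ → ℂ) :
    ∫ x : EuclideanSpace ℝ S, φ x * h ‖x‖ =
      (∫ u, φ u.1 ∂((volume : Measure (EuclideanSpace ℝ S)).toSphere)) *
        ∫ y in Set.Ioi (0 : ℝ), (y : ℂ) ^ (Fintype.card S - 1) * h y := by
  let E := EuclideanSpace ℝ S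
  let μ : Measure E := volume
  have hd : Module.finrank ℝ E = Fintype.card S := finrank_euclideanSpace
  calc
    ∫ x, φ x * h ‖x‖ ∂μ = ∫ x : ({(0)}ᶜ : Set E), φ x.1 * h (‖x.1‖) ∂(μ.comap (↑)) := by
      rw [integral_subtype_comap (measurableSet_singleton _).compl fun x ↦ φ x * h (‖x‖),
        restrict_compl_singleton]
    _ = ∫ x, φ x.1.1 * h x.2 ∂μ.toSphere.prod (.volumeIoiPow (Module.finrank ℝ E - 1)) := by
      rw [← μ.measurePreserving_homeomorphUnitSphereProd.integral_comp
        (Homeomorph.measurableEmbedding _)]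
      congr 1
      ext x
      have hx : 0 < ‖x.1‖ := norm_pos_iff.2 x.2
      simp only [homeomorphUnitSphereProd_apply_fst_coe, homeomorphUnitSphereProd_apply_snd_coe]
      rw [hφ _ _ (inv_pos.2 hx)]
    _ = (∫ u, φ u.1 ∂μ.toSphere) *
        ∫ x : Set.Ioi (0 : ℝ), h x ∂.volumeIoiPow (Module.finrank ℝ E - 1) :=
      integral_prod_mul (fun u : Metric.sphere (0 : E) 1 => φ u.1) (fun x : Set.Ioi (0:ℝ) => h x)
    _ = _ := by
      congr 1
      simp only [Measure.volumeIoiPow, ENNReal.ofReal]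
      rw [integral_withDensity_eq_integral_smul, 
        integral_subtype_comap measurableSet_Ioi fun a ↦ Real.toNNReal (a ^ (Module.finrank ℝ E - 1)) • h a,
        setIntegral_congr_fun measurableSet_Ioi fun x hx ↦ ?_]
      · rw [NNReal.smul_def, Real.coe_toNNReal _ (pow_nonneg hx.out.le _), hd, Complex.real_smul,
          Complex.ofReal_pow]
      · exact (measurable_subtype_coe.pow_const _).real_toNNReal

/-- radial integral -/
lemma radial (d : ℕ) (hd : 0 < d) (s : ℂ) (hs : s.re = 0) :
    ∫ y in Set.Ioi (0 : ℝ), (y : ℂ) ^ (d - 1) *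
      (Complex.exp (s * (Real.log (y ^ 2) : ℂ)) * Complex.exp (-(y : ℂ) ^ 2 / 2)) =
    (2 : ℂ)⁻¹ * ((2 : ℂ) ^ ((d : ℂ) / 2 + s) * Complex.Gamma ((d : ℂ) / 2 + s)) := by
  have ha : 0 < ((d : ℂ) / 2 + s).re := by
    simp [hs]; positivity
  have h1 := Complex.integral_cpow_mul_exp_neg_mul_Ioi ha (r := 1 / 2) (by norm_num)
  rw [← integral_comp_rpow_Ioi_of_pos (p := 2) two_pos] at h1
  have : (1 / ((1 / 2 : ℝ) : ℂ)) = 2 := by push_cast; norm_num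
  rw [this] at h1
  rw [← h1, ← integral_const_mul]
  refine setIntegral_congr_fun measurableSet_Ioi fun y hy => ?_
  have hy : 0 < y := hy
  have hyc : (y : ℂ) ≠ 0 := by exact_mod_cast hy.ne'
  simp only [Complex.real_smul]
  have e1 : (((y : ℝ) ^ (2 : ℝ) : ℝ) : ℂ) ^ ((d : ℂ) / 2 + s - 1)
      = Complex.exp ((Real.log (y ^ 2) : ℂ) * ((d : ℂ) / 2 + s - 1)) := by
    rw [Complex.cpow_def_of_ne_zero, ← Complex.ofReal_log (by positivity)]
    · norm_num
    · norm_cast; positivity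
  rw [e1]
  have e2 : (y : ℂ) ^ (d - 1) = Complex.exp ((Real.log y : ℂ) * (d - 1)) := by
    rw [← Complex.cpow_natCast, Complex.cpow_def_of_ne_zero hyc, ← Complex.ofReal_log hy.le,
      Nat.cast_sub hd, Nat.cast_one]
  have e3 : ((2 * y ^ ((2 : ℝ) - 1) : ℝ) : ℂ) = 2 * Complex.exp (Real.log y : ℂ) := by
    rw [← Complex.ofReal_exp, Real.exp_log hy]; norm_num
  have e4 : (Real.log (y ^ 2) : ℂ) = 2 * (Real.log y : ℂ) := by
    rw [Real.log_pow]; push_cast; ring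
  rw [e2, e3, e4]
  have e5 : (-(((1 / 2 : ℝ) : ℂ) * ((y ^ (2 : ℝ) : ℝ) : ℂ))) = -(y : ℂ) ^ 2 / 2 := by
    norm_num; ring
  rw [e5]
  have e6 : ∀ a b c : ℂ, (2 : ℂ)⁻¹ * (2 * a * (b * c)) = a * b * c := by intros; ring
  rw [e6, ← Complex.exp_add, ← Complex.exp_add, ← Complex.exp_add, ← Complex.exp_add]
  congr 1
  ring

/-- chi-square complex moment -/
noncomputable def K (d : ℕ) (s : ℂ) : ℂ :=
  (2 : ℂ) ^ s * Complex.Gamma ((d : ℂ) / 2 + s) / Complex.Gamma ((d : ℂ) / 2)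

lemma Gamma_half_ne (d : ℕ) (hd : 0 < d) (s : ℂ) (hs : s.re = 0) :
    Complex.Gamma ((d : ℂ) / 2 + s) ≠ 0 := by
  apply Complex.Gamma_ne_zero_of_re_pos
  simp [hs]; positivity

lemma K_ne (d : ℕ) (hd : 0 < d) (s : ℂ) (hs : s.re = 0) : K d s ≠ 0 := by
  unfold K
  refine div_ne_zero (mul_ne_zero ?_ (Gamma_half_ne d hd s hs)) ?_
  · simp [Complex.cpow_def]
  · simpa using Gamma_half_ne d hd 0 rfl

lemma moment_hom {S : Type*} [Fintype S] [Nonempty S] (φ : (S → ℝ) → ℂ)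
    (hφ : ∀ (r : ℝ) x, 0 < r → φ (r • x) = φ x) (s : ℂ) (hs : s.re = 0) :
    ∫ x, φ x * Complex.exp (s * (Real.log (∑ i, x i ^ 2) : ℂ)) ∂(gam S)
      = (∫ x, φ x ∂(gam S)) * K (Fintype.card S) s := by
  have key : ∀ s : ℂ, s.re = 0 →
      ∫ x, φ x * Complex.exp (s * (Real.log (∑ i, x i ^ 2) : ℂ)) ∂(gam S) =
      ((√(2 * π))⁻¹ : ℂ) ^ Fintype.card S * ((∫ u, φ (WithLp.ofLp u.1)
        ∂((volume : Measure (EuclideanSpace ℝ S)).toSphere)) *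
        ((2 : ℂ)⁻¹ * ((2 : ℂ) ^ ((Fintype.card S : ℂ) / 2 + s) *
          Complex.Gamma ((Fintype.card S : ℂ) / 2 + s)))) := by
    intro s hs
    rw [integral_gam, ← radial _ Fintype.card_pos s hs,
      ← polar (fun x : EuclideanSpace ℝ S => φ (WithLp.ofLp x)) (fun r x hr => hφ r _ hr)]
    congr 2
    ext x
    rw [EuclideanSpace.real_norm_sq_eq, mul_assoc]
  have h0 := key 0 rfl
  simp only [zero_mul, Complex.exp_zero, mul_one, add_zero] at h0
  rw [key s hs, h0, K, Complex.cpow_add _ _ two_ne_zero]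
  have := Gamma_half_ne (Fintype.card S) Fintype.card_pos 0 rfl
  rw [add_zero] at this
  field_simp

lemma moment_chi (S : Type*) [Fintype S] [Nonempty S] (s : ℂ) (hs : s.re = 0) :
    ∫ x, Complex.exp (s * (Real.log (∑ i, x i ^ 2) : ℂ)) ∂(gam S) = K (Fintype.card S) s := by
  have := moment_hom (S := S) (fun _ => 1) (fun _ _ _ => rfl) s hs
  simpa using this

lemma gam_restrict {S : Type*} [Fintype S] (p : S → Prop) [DecidablePred p] :
    MeasurePreserving (fun (x : S → ℝ) (i : {i // p i}) => x i) (gam S) (gam {i // p i}) := by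
  have h := measurePreserving_piEquivPiSubtypeProd (fun _ : S => gaussianReal 0 1) p
  exact measurePreserving_fst.comp h

lemma gam_ne_zero {S : Type*} [Fintype S] (i : S) : ∀ᵐ x ∂(gam S), x i ≠ 0 := by
  have h := measurePreserving_eval (fun _ : S => gaussianReal 0 1) i
  have h2 : ∀ᵐ y ∂(gaussianReal 0 1), y ≠ 0 := by
    rw [ae_iff]
    simp only [not_not, Set.ofPred_eq_eq_singleton]
    have := nullSingletonClass_gaussianReal (μ := 0) (v := 1) one_ne_zero
    exact measure_singleton _
  exact h.quasiMeasurePreserving.ae h2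

lemma ratio_full {S : Type*} [Fintype S] (p : S → Prop) [DecidablePred p] (hp : ∃ i, p i)
    (s : ℂ) (hs : s.re = 0) :
    ∫ x, Complex.exp (s * (Real.log ((∑ i with p i, x i ^ 2) / ∑ i, x i ^ 2) : ℂ)) ∂(gam S)
      = K (Fintype.card {i // p i}) s / K (Fintype.card S) s := by
  obtain ⟨i0, hi0⟩ := hp
  have : Nonempty S := ⟨i0⟩
  have : Nonempty {i // p i} := ⟨⟨i0, hi0⟩⟩
  have h1 := moment_hom (S := S) (fun x => Complex.exp (s * (Real.log ((∑ i with p i, x i ^ 2) / ∑ i, x i ^ 2) : ℂ)))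
    (by
      intro r x hr
      simp only [Pi.smul_apply, smul_eq_mul, mul_pow, ← Finset.mul_sum]
      rw [mul_div_mul_left _ _ (by positivity)]) s hs
  rw [eq_div_iff (K_ne _ Fintype.card_pos s hs), ← h1, ← moment_chi {i // p i} s hs,
    ← (gam_restrict p).map_eq, integral_map (gam_restrict p).aemeasurable]
  · refine integral_congr_ae ?_
    filter_upwards [gam_ne_zero i0] with x hx
    rw [← Complex.exp_add, ← mul_add, ← Complex.ofReal_add, ← Real.log_mul]
    · congr 4
      rw [div_mul_cancel₀]
      · rw [Finset.sum_subtype]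
        simp
      · have : 0 < ∑ i, x i ^ 2 := Finset.sum_pos' (fun i _ => sq_nonneg _) ⟨i0, Finset.mem_univ _, by positivity⟩
        exact this.ne'
    · have : 0 < ∑ i, x i ^ 2 := Finset.sum_pos' (fun i _ => sq_nonneg _) ⟨i0, Finset.mem_univ _, by positivity⟩
      have : 0 < ∑ i with p i, x i ^ 2 := Finset.sum_pos' (fun i _ => sq_nonneg _) ⟨i0, by simpa using hi0, by positivity⟩
      positivity
    · have : 0 < ∑ i, x i ^ 2 := Finset.sum_pos' (fun i _ => sq_nonneg _) ⟨i0, Finset.mem_univ _, by positivity⟩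
      exact this.ne'
  · apply Measurable.aestronglyMeasurable
    fun_prop

lemma ratio_sub {S : Type*} [Fintype S] (p q : S → Prop) [DecidablePred p] [DecidablePred q]
    (hp : ∃ i, p i) (hpq : ∀ i, p i → q i)
    (s : ℂ) (hs : s.re = 0) :
    ∫ x, Complex.exp (s * (Real.log ((∑ i with p i, x i ^ 2) / ∑ i with q i, x i ^ 2) : ℂ)) ∂(gam S)
      = K (Fintype.card {i // p i}) s / K (Fintype.card {i // q i}) s := by
  obtain ⟨i0, hi0⟩ := hp
  have h := ratio_full (S := {i // q i}) (fun i => p i) ⟨⟨i0, hpq _ hi0⟩, hi0⟩ s hs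
  have hc : Fintype.card {i : {i // q i} // p i} = Fintype.card {i // p i} :=
    Fintype.card_congr ⟨fun i => ⟨i.1.1, i.2⟩, fun i => ⟨⟨i.1, hpq _ i.2⟩, i.2⟩,
      fun i => rfl, fun i => rfl⟩
  rw [hc] at h
  rw [← h, ← (gam_restrict q).map_eq, integral_map (gam_restrict q).aemeasurable]
  · congr 1
    ext x
    have e1 : ∑ i with p i, x i ^ 2 = ∑ i : {i // q i} with p i.1, x i.1 ^ 2 := by
      symm
      refine Finset.sum_bij (fun i _ => i.1) ?_ ?_ ?_ ?_
      · simp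
      · intro a _ b _ h
        exact Subtype.ext h
      · intro b hb
        simp only [Finset.mem_filter, Finset.mem_univ, true_and] at hb
        exact ⟨⟨b, hpq _ hb⟩, by simpa using hb, rfl⟩
      · simp
    have e2 : ∑ i with q i, x i ^ 2 = ∑ i : {i // q i}, x i ^ 2 := by
      rw [Finset.sum_subtype]
      simp
    rw [e1, e2]
  · apply Measurable.aestronglyMeasurable
    fun_prop

end Wilks

namespace Wilks

lemma gam_orth {ι : Type*} [Fintype ι] [DecidableEq ι] (b : OrthonormalBasis ι ℝ (EuclideanSpace ℝ ι)) :
    MeasurePreserving (fun x : ι → ℝ => (Matrix.of fun j i => b i j) *ᵥ x) (gam ι) (gam ι) := by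
  have h1 := map_pi_eq_stdGaussian (ι := ι)
  have h2 := stdGaussian_eq_map_pi_orthonormalBasis b
  have hm : Measurable (fun x : ι → ℝ => (Matrix.of fun j i => b i j) *ᵥ x) := by
    apply Continuous.measurable; fun_prop
  refine ⟨hm, ?_⟩
  have h3 : (Measure.map (WithLp.toLp 2) (gam ι)) = Measure.map (fun x ↦ ∑ i, x i • b i) (gam ι) := h1.trans h2
  have h4 := congrArg (Measure.map (WithLp.ofLp : EuclideanSpace ℝ ι → (ι → ℝ))) h3
  rw [Measure.map_map (by fun_prop) (by fun_prop), Measure.map_map (by fun_prop) (by fun_prop)] at h4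
  have e1 : (WithLp.ofLp : EuclideanSpace ℝ ι → (ι → ℝ)) ∘ (WithLp.toLp 2) = id := rfl
  rw [e1, Measure.map_id] at h4
  conv_rhs => rw [h4]
  congr 1
  ext x j
  simp [Matrix.mulVec, dotProduct, mul_comm]

lemma proj_ratio {ι : Type*} [Fintype ι] [DecidableEq ι] (R₁ R₀ : Matrix ι ι ℝ)
    (h1t : R₁ᵀ = R₁) (h0t : R₀ᵀ = R₀) (h1 : R₁ * R₁ = R₁) (h0 : R₀ * R₀ = R₀)
    (h01 : R₀ * R₁ = R₁) (r₁ r₀ : ℕ) (htr1 : R₁.trace = r₁) (htr0 : R₀.trace = r₀) (hr : 0 < r₁)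
    (s : ℂ) (hs : s.re = 0) :
    ∫ x, Complex.exp (s * (Real.log ((x ⬝ᵥ R₁ *ᵥ x) / (x ⬝ᵥ R₀ *ᵥ x)) : ℂ)) ∂(gam ι)
      = K r₁ s / K r₀ s ∧ ∀ᵐ x ∂(gam ι), 0 < x ⬝ᵥ R₁ *ᵥ x := by
  have h10 : R₁ * R₀ = R₁ := by
    have := congrArg transpose h01
    rwa [transpose_mul, h1t, h0t] at this
  set T := R₀ + R₁ with hT
  have hTh : T.IsHermitian := by
    rw [Matrix.IsHermitian, conjTranspose_eq_transpose_of_trivial, hT, transpose_add, h1t, h0t]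
  set U : Matrix ι ι ℝ := Matrix.of fun j i => hTh.eigenvectorBasis i j with hU
  set D : Matrix ι ι ℝ := diagonal hTh.eigenvalues with hD
  have hUU : U * Uᵀ = 1 := by
    have := Unitary.mul_star_self_of_mem hTh.eigenvectorUnitary.2
    exact this
  have hUU' : Uᵀ * U = 1 := by
    have := Unitary.star_mul_self_of_mem hTh.eigenvectorUnitary.2
    exact this
  have hspec : T = U * D * Uᵀ := by
    have := hTh.spectral_theorem
    rw [Unitary.conjStarAlgAut_apply] at this
    exact this
  have hTU : Uᵀ * T * U = D := by
    rw [hspec]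
    calc Uᵀ * (U * D * Uᵀ) * U = (Uᵀ * U) * D * (Uᵀ * U) := by simp only [Matrix.mul_assoc]
      _ = D := by rw [hUU', Matrix.one_mul, Matrix.mul_one]
  have hR1 : R₁ = (1 / 2 : ℝ) • (T * T - T) := by
    rw [hT, Matrix.add_mul, Matrix.mul_add, Matrix.mul_add, h1, h0, h01, h10, show R₀ + R₁ + (R₁ + R₁) - (R₀ + R₁) = (2:ℝ) • R₁ by rw [two_smul]; abel, smul_smul]
    norm_num
  have conj_mul : ∀ A B : Matrix ι ι ℝ, Uᵀ * (A * B) * U = (Uᵀ * A * U) * (Uᵀ * B * U) := by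
    intro A B
    calc Uᵀ * (A * B) * U = Uᵀ * A * 1 * B * U := by simp only [Matrix.mul_assoc, Matrix.mul_one, Matrix.one_mul]
      _ = _ := by rw [← hUU]; simp only [Matrix.mul_assoc]
  have tr_conj : ∀ A : Matrix ι ι ℝ, (Uᵀ * A * U).trace = A.trace := by
    intro A
    rw [Matrix.trace_mul_comm, ← Matrix.mul_assoc, hUU, Matrix.one_mul]
  have dot_conj : ∀ (A : Matrix ι ι ℝ) (x : ι → ℝ), (U *ᵥ x) ⬝ᵥ A *ᵥ (U *ᵥ x) = x ⬝ᵥ (Uᵀ * A * U) *ᵥ x := by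
    intro A x
    rw [← Matrix.mulVec_mulVec, ← Matrix.mulVec_mulVec, Matrix.dotProduct_mulVec x, Matrix.vecMul_transpose]
  obtain ⟨μ, hμ⟩ : ∃ μ : ι → ℝ, Uᵀ * R₁ * U = diagonal μ := by
    refine ⟨fun i => (1/2) * (hTh.eigenvalues i * hTh.eigenvalues i - hTh.eigenvalues i), ?_⟩
    rw [hR1, Matrix.mul_smul, Matrix.smul_mul, Matrix.mul_sub, Matrix.sub_mul, conj_mul, hTU, hD,
      diagonal_mul_diagonal, diagonal_sub, ← diagonal_smul]
    rfl
  obtain ⟨ν, hν⟩ : ∃ ν : ι → ℝ, Uᵀ * R₀ * U = diagonal ν := by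
    refine ⟨fun i => hTh.eigenvalues i - μ i, ?_⟩
    rw [show R₀ = T - R₁ by rw [hT]; abel, Matrix.mul_sub, Matrix.sub_mul, hTU, hμ, hD, diagonal_sub]
  have hμ2 : ∀ i, μ i = 0 ∨ μ i = 1 := by
    intro i
    have := conj_mul R₁ R₁
    rw [h1, hμ, diagonal_mul_diagonal] at this
    have := congrFun (diagonal_injective this) i
    have h : μ i * (μ i - 1) = 0 := by linarith
    rcases mul_eq_zero.1 h with h | h
    · left; exact h
    · right; linarith
  have hν2 : ∀ i, ν i = 0 ∨ ν i = 1 := by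
    intro i
    have := conj_mul R₀ R₀
    rw [h0, hν, diagonal_mul_diagonal] at this
    have := congrFun (diagonal_injective this) i
    have h : ν i * (ν i - 1) = 0 := by linarith
    rcases mul_eq_zero.1 h with h | h
    · left; exact h
    · right; linarith
  have hμν : ∀ i, μ i = 1 → ν i = 1 := by
    intro i hi
    have := conj_mul R₀ R₁
    rw [h01, hν, hμ, diagonal_mul_diagonal] at this
    have := congrFun (diagonal_injective this) i
    simp only [hi] at this
    linarith
  classical
  have sum1 : ∀ f : ι → ℝ, ∑ i, μ i * f i = ∑ i with μ i = 1, f i := by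
    intro f
    rw [Finset.sum_filter]
    refine Finset.sum_congr rfl fun i _ => ?_
    rcases hμ2 i with h | h <;> simp [h]
  have sum0 : ∀ f : ι → ℝ, ∑ i, ν i * f i = ∑ i with ν i = 1, f i := by
    intro f
    rw [Finset.sum_filter]
    refine Finset.sum_congr rfl fun i _ => ?_
    rcases hν2 i with h | h <;> simp [h]
  have c1 : Fintype.card {i // μ i = 1} = r₁ := by
    have := tr_conj R₁
    rw [hμ, htr1, trace_diagonal] at this
    have h := sum1 (fun _ => 1)
    simp only [mul_one, this, Finset.sum_const, nsmul_eq_mul] at h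
    rw [Fintype.card_subtype]
    exact_mod_cast h.symm
  have c0 : Fintype.card {i // ν i = 1} = r₀ := by
    have := tr_conj R₀
    rw [hν, htr0, trace_diagonal] at this
    have h := sum0 (fun _ => 1)
    simp only [mul_one, this, Finset.sum_const, nsmul_eq_mul] at h
    rw [Fintype.card_subtype]
    exact_mod_cast h.symm
  have hex : ∃ i, μ i = 1 := by
    rw [← c1] at hr
    obtain ⟨i, hi⟩ := Fintype.card_pos_iff.1 hr
    exact ⟨i, hi⟩
  have hq1 : ∀ x, (U *ᵥ x) ⬝ᵥ R₁ *ᵥ (U *ᵥ x) = ∑ i with μ i = 1, x i ^ 2 := by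
    intro x
    rw [dot_conj, hμ, ← sum1]
    simp only [dotProduct, mulVec_diagonal]
    exact Finset.sum_congr rfl fun i _ => by ring
  have hq0 : ∀ x, (U *ᵥ x) ⬝ᵥ R₀ *ᵥ (U *ᵥ x) = ∑ i with ν i = 1, x i ^ 2 := by
    intro x
    rw [dot_conj, hν, ← sum0]
    simp only [dotProduct, mulVec_diagonal]
    exact Finset.sum_congr rfl fun i _ => by ring
  have hmp : MeasurePreserving (fun x => U *ᵥ x) (gam ι) (gam ι) := gam_orth hTh.eigenvectorBasis
  constructor
  · rw [← c1, ← c0, ← ratio_sub (fun i => μ i = 1) (fun i => ν i = 1) hex hμν s hs]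
    conv_lhs => rw [← hmp.map_eq]
    rw [integral_map hmp.aemeasurable]
    · simp only [hq1, hq0]
    · apply Measurable.aestronglyMeasurable
      have m1 : Measurable (fun x : ι → ℝ => x ⬝ᵥ R₁ *ᵥ x) := by
        apply Continuous.measurable; fun_prop
      have m0 : Measurable (fun x : ι → ℝ => x ⬝ᵥ R₀ *ᵥ x) := by
        apply Continuous.measurable; fun_prop
      fun_prop
  · obtain ⟨i0, hi0⟩ := hex
    have m1 : Measurable (fun x : ι → ℝ => x ⬝ᵥ R₁ *ᵥ x) := by
        apply Continuous.measurable; fun_prop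
    rw [← hmp.map_eq, ae_map_iff hmp.aemeasurable (measurableSet_lt measurable_const m1)]
    filter_upwards [gam_ne_zero i0] with x hx
    rw [hq1]
    exact Finset.sum_pos' (fun i _ => sq_nonneg _) ⟨i0, by simpa using hi0, by positivity⟩

end Wilks

namespace Wilks

set_option linter.unusedSectionVars false

variable {ι : Type*} [Fintype ι] [DecidableEq ι]

/-- Gram-type matrix -/
def Gr {k : ℕ} (P : Matrix ι ι ℝ) (V : Fin k → ι → ℝ) : Matrix (Fin k) (Fin k) ℝ :=
  Matrix.of V * P * (Matrix.of V)ᵀ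

/-- Residual projection -/
noncomputable def Rs {k : ℕ} (P : Matrix ι ι ℝ) (V : Fin k → ι → ℝ) : Matrix ι ι ℝ :=
  P - P * (Matrix.of V)ᵀ * (Gr P V)⁻¹ * Matrix.of V * P

lemma Gr_t {k : ℕ} {P : Matrix ι ι ℝ} (hPt : Pᵀ = P) (V : Fin k → ι → ℝ) : (Gr P V)ᵀ = Gr P V := by
  simp [Gr, transpose_mul, hPt, Matrix.mul_assoc]

lemma Rs_t {k : ℕ} {P : Matrix ι ι ℝ} (hPt : Pᵀ = P) (V : Fin k → ι → ℝ) : (Rs P V)ᵀ = Rs P V := by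
  simp only [Rs, transpose_sub, transpose_mul, hPt, Matrix.mul_assoc, transpose_nonsing_inv, Gr_t hPt,
    transpose_transpose]

lemma V_Rs {k : ℕ} {P : Matrix ι ι ℝ} (V : Fin k → ι → ℝ) (hV : (Gr P V).det ≠ 0) :
    Matrix.of V * Rs P V = 0 := by
  have : IsUnit (Gr P V).det := isUnit_iff_ne_zero.2 hV
  rw [Rs, Matrix.mul_sub, sub_eq_zero]
  calc Matrix.of V * P = (1 : Matrix (Fin k) (Fin k) ℝ) * (Matrix.of V * P) := by rw [Matrix.one_mul]
    _ = (Gr P V * (Gr P V)⁻¹) * (Matrix.of V * P) := by rw [Matrix.mul_nonsing_inv _ this]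
    _ = _ := by simp only [Gr, Matrix.mul_assoc]

lemma Q_Rs {k : ℕ} {P Q : Matrix ι ι ℝ} (hQ : Q * P = P) (V : Fin k → ι → ℝ) :
    Q * Rs P V = Rs P V := by
  simp only [Rs, Matrix.mul_sub, ← Matrix.mul_assoc, hQ]

lemma Rs_Rs {k : ℕ} {P Q : Matrix ι ι ℝ} (hQ : Q * P = P) (V : Fin k → ι → ℝ)
    (hV : (Gr P V).det ≠ 0) : Rs Q V * Rs P V = Rs P V := by
  conv_lhs => rw [Rs, Matrix.sub_mul]
  simp only [Matrix.mul_assoc]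
  rw [Q_Rs hQ, V_Rs V hV]
  simp

lemma Rs_tr {k : ℕ} {P : Matrix ι ι ℝ} (hP : P * P = P) (V : Fin k → ι → ℝ)
    (hV : (Gr P V).det ≠ 0) : (Rs P V).trace = P.trace - k := by
  have : IsUnit (Gr P V).det := isUnit_iff_ne_zero.2 hV
  rw [Rs, trace_sub]
  congr 1
  rw [show P * (Matrix.of V)ᵀ * (Gr P V)⁻¹ * Matrix.of V * P = (P * (Matrix.of V)ᵀ * (Gr P V)⁻¹) * (Matrix.of V * P) by
    simp only [Matrix.mul_assoc], Matrix.trace_mul_comm,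
    show Matrix.of V * P * (P * (Matrix.of V)ᵀ * (Gr P V)⁻¹) = Matrix.of V * (P * P) * (Matrix.of V)ᵀ * (Gr P V)⁻¹ by
    simp only [Matrix.mul_assoc], hP]
  change (Gr P V * (Gr P V)⁻¹).trace = _
  rw [Matrix.mul_nonsing_inv _ this]
  simp

lemma Gr_cons {k : ℕ} {P : Matrix ι ι ℝ} (V : Fin k → ι → ℝ) (w : ι → ℝ)
    (hV : (Gr P V).det ≠ 0) :
    (Gr P (Fin.cons w V : Fin (k+1) → ι → ℝ)).det = (Gr P V).det * (w ⬝ᵥ Rs P V *ᵥ w) := by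
  have hu : IsUnit (Gr P V).det := isUnit_iff_ne_zero.2 hV
  let W : Matrix Unit ι ℝ := Matrix.of fun _ => w
  let e : Unit ⊕ Fin k ≃ Fin (k+1) :=
    ⟨Sum.elim (fun _ => 0) Fin.succ, Fin.cases (Sum.inl ()) Sum.inr, by
      rintro (⟨⟩ | i) <;> simp, by
      intro i; refine Fin.cases ?_ ?_ i <;> simp⟩
  let _ := (Gr P V).invertibleOfIsUnitDet hu
  have h1 : (Gr P (Fin.cons w V : Fin (k+1) → ι → ℝ)).submatrix e e
      = fromBlocks (W * P * Wᵀ) (W * P * (Matrix.of V)ᵀ) (Matrix.of V * P * Wᵀ) (Gr P V) := by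
    ext i j
    rcases i with i | i <;> rcases j with j | j <;>
      simp [Gr, e, W, Matrix.mul_apply]
  rw [← Matrix.det_submatrix_equiv_self e, h1, Matrix.det_fromBlocks₂₂, Matrix.invOf_eq_nonsing_inv]
  congr 1
  rw [Matrix.det_unique]
  have h2 : W * P * Wᵀ - W * P * (Matrix.of V)ᵀ * (Gr P V)⁻¹ * (Matrix.of V * P * Wᵀ) = W * Rs P V * Wᵀ := by
    simp only [Rs, Matrix.mul_sub, Matrix.sub_mul, Matrix.mul_assoc]
  rw [h2, Matrix.mul_assoc]
  simp only [W, Matrix.mul_apply, dotProduct, mulVec, Matrix.transpose_apply, Matrix.of_apply]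

lemma meas_Gr {k : ℕ} (P : Matrix ι ι ℝ) : Measurable fun V : Fin k → ι → ℝ => (Gr P V).det := by
  apply Continuous.measurable
  unfold Gr
  have : Continuous (fun V : Fin k → ι → ℝ => (Matrix.of V : Matrix (Fin k) ι ℝ)) := continuous_id
  fun_prop

lemma gram_law (P₁ P₀ : Matrix ι ι ℝ)
    (h1t : P₁ᵀ = P₁) (h0t : P₀ᵀ = P₀) (h1 : P₁ * P₁ = P₁) (h0 : P₀ * P₀ = P₀)
    (h01 : P₀ * P₁ = P₁) (r₁ r₀ : ℕ) (htr1 : P₁.trace = r₁) (htr0 : P₀.trace = r₀) (hr : r₁ ≤ r₀)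
    (s : ℂ) (hs : s.re = 0) (k : ℕ) (hk : k ≤ r₁) :
    (∀ᵐ V ∂(Measure.pi fun _ : Fin k => gam ι), (Gr P₁ V).det ≠ 0 ∧ (Gr P₀ V).det ≠ 0) ∧
    ∫ V, Complex.exp (s * (Real.log ((Gr P₁ V).det / (Gr P₀ V).det) : ℂ))
      ∂(Measure.pi fun _ : Fin k => gam ι) =
      ∏ j ∈ Finset.range k, K (r₁ - j) s / K (r₀ - j) s := by
  induction k with
  | zero => simp
  | succ k ih =>
    obtain ⟨ih1, ih2⟩ := ih (by omega)
    set μ := Measure.pi fun _ : Fin k => gam ι with hμ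
    have hmp : MeasurePreserving (fun z : (Fin k → ι → ℝ) × (ι → ℝ) => (Fin.cons z.2 z.1 : Fin (k+1) → ι → ℝ))
        (μ.prod (gam ι)) (Measure.pi fun _ : Fin (k+1) => gam ι) := by
      have a := (measurePreserving_piFinSuccAbove (fun _ : Fin (k+1) => gam ι) 0).symm
      have b := Measure.measurePreserving_swap (μ := μ) (ν := gam ι)
      have := a.comp b
      convert this using 1
      ext z
      simp [MeasurableEquiv.piFinSuccAbove, Fin.insertNthEquiv]
    have hmeas : ∀ k, Measurable (fun V : Fin k → ι → ℝ =>
        Complex.exp (s * (Real.log ((Gr P₁ V).det / (Gr P₀ V).det) : ℂ))) := by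
      intro k
      have m1 := meas_Gr (k := k) P₁
      have m0 := meas_Gr (k := k) P₀
      fun_prop
    have hset : ∀ k, MeasurableSet {V : Fin k → ι → ℝ | (Gr P₁ V).det ≠ 0 ∧ (Gr P₀ V).det ≠ 0} := by
      intro k
      have m1 := meas_Gr (k := k) P₁
      have m0 := meas_Gr (k := k) P₀
      exact ((m1 (measurableSet_singleton 0)).compl).inter ((m0 (measurableSet_singleton 0)).compl)
    have step : ∀ V : Fin k → ι → ℝ, (Gr P₁ V).det ≠ 0 → (Gr P₀ V).det ≠ 0 →
        ∫ w, Complex.exp (s * (Real.log ((w ⬝ᵥ Rs P₁ V *ᵥ w) / (w ⬝ᵥ Rs P₀ V *ᵥ w)) : ℂ)) ∂(gam ι)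
        = K (r₁ - k) s / K (r₀ - k) s ∧ (∀ᵐ x ∂(gam ι), 0 < x ⬝ᵥ Rs P₁ V *ᵥ x) ∧
          ∀ᵐ x ∂(gam ι), 0 < x ⬝ᵥ Rs P₀ V *ᵥ x := by
      intro V hV1 hV0
      have t1 : (Rs P₁ V).trace = ((r₁ - k : ℕ) : ℝ) := by
        rw [Rs_tr h1 V hV1, htr1, Nat.cast_sub (by omega)]
      have t0 : (Rs P₀ V).trace = ((r₀ - k : ℕ) : ℝ) := by
        rw [Rs_tr h0 V hV0, htr0, Nat.cast_sub (by omega)]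
      have A := proj_ratio (Rs P₁ V) (Rs P₀ V) (Rs_t h1t V) (Rs_t h0t V) (Rs_Rs h1 V hV1)
        (Rs_Rs h0 V hV0) (Rs_Rs h01 V hV1) _ _ t1 t0 (by omega) s hs
      have B := proj_ratio (Rs P₀ V) (Rs P₀ V) (Rs_t h0t V) (Rs_t h0t V) (Rs_Rs h0 V hV0)
        (Rs_Rs h0 V hV0) (Rs_Rs h0 V hV0) _ _ t0 t0 (by omega) s hs
      exact ⟨A.1, A.2, B.2⟩
    constructor
    · rw [← hmp.map_eq, ae_map_iff hmp.aemeasurable (hset _), Measure.ae_prod_iff_ae_ae]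
      · filter_upwards [ih1] with V hV
        obtain ⟨-, a1, a0⟩ := step V hV.1 hV.2
        filter_upwards [a1, a0] with w w1 w0
        rw [Gr_cons V w hV.1, Gr_cons V w hV.2]
        exact ⟨mul_ne_zero hV.1 w1.ne', mul_ne_zero hV.2 w0.ne'⟩
      · exact hmp.measurable (hset _)
    · rw [← hmp.map_eq, integral_map hmp.aemeasurable (hmeas _).aestronglyMeasurable,
        integral_prod, Finset.prod_range_succ, ← ih2, ← integral_mul_const]
      · refine integral_congr_ae ?_
        filter_upwards [ih1] with V hV
        obtain ⟨st, a1, a0⟩ := step V hV.1 hV.2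
        rw [← st, ← integral_const_mul]
        refine integral_congr_ae ?_
        filter_upwards [a1, a0] with w w1 w0
        rw [Gr_cons V w hV.1, Gr_cons V w hV.2, ← Complex.exp_add, ← mul_add, ← Complex.ofReal_add,
          ← Real.log_mul (div_ne_zero hV.1 hV.2) (div_ne_zero w1.ne' w0.ne'), div_mul_div_comm]
      · refine Integrable.of_bound ((hmeas _).comp hmp.measurable).aestronglyMeasurable 1 ?_
        refine Filter.Eventually.of_forall fun z => ?_
        simp [Complex.norm_exp, hs]

end Wilks

namespace Wilks

lemma exists_whiten {k : ℕ} (S : Matrix (Fin k) (Fin k) ℝ) (hS : S.PosDef) :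
    ∃ A : Matrix (Fin k) (Fin k) ℝ, A.det ≠ 0 ∧ A * S * Aᵀ = 1 := by
  open scoped MatrixOrder in
  obtain ⟨C, hC⟩ := CStarAlgebra.nonneg_iff_eq_star_mul_self.mp hS.posSemidef.nonneg
  rw [Matrix.star_eq_conjTranspose, Matrix.conjTranspose_eq_transpose_of_trivial] at hC
  have hd : C.det ≠ 0 := by
    intro h
    have := hS.det_pos
    rw [hC, Matrix.det_mul, h, mul_zero] at this
    exact lt_irrefl _ this
  have hu : IsUnit C.det := isUnit_iff_ne_zero.mpr hd
  refine ⟨(C⁻¹)ᵀ, ?_, ?_⟩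
  · rw [Matrix.det_transpose]
    exact (Matrix.isUnit_nonsing_inv_det C hu).ne_zero
  · rw [hC, Matrix.transpose_transpose, ← Matrix.mul_assoc, ← Matrix.transpose_mul, Matrix.mul_nonsing_inv _ hu,
      Matrix.transpose_one, Matrix.one_mul, Matrix.mul_nonsing_inv _ hu]

lemma map_whiten {Ω : Type*} [MeasurableSpace Ω] (P : Measure Ω) [IsProbabilityMeasure P] {k : ℕ}
    (S A : Matrix (Fin k) (Fin k) ℝ) (hA : A * S * Aᵀ = 1) (X : Ω → Fin k → ℝ) (hX : Measurable X)
    (hg : ∀ u : Fin k → ℝ, Measure.map (fun ω => ∑ j, u j * X ω j) P =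
        gaussianReal 0 (Real.toNNReal (∑ j, ∑ l, u j * S j l * u l))) :
    Measure.map (fun ω => A *ᵥ X ω) P = gam (Fin k) := by
  have hm : Measurable (fun ω => A *ᵥ X ω) := by
    have : Continuous fun x : Fin k → ℝ => A *ᵥ x := by fun_prop
    exact this.measurable.comp hX
  have : IsProbabilityMeasure (Measure.map (fun ω => A *ᵥ X ω) P) :=
    Measure.isProbabilityMeasure_map hm.aemeasurable
  unfold gam
  rw [← charFun_eq_pi_iff]
  intro t
  have hL : Measurable (WithLp.toLp 2 : (Fin k → ℝ) → WithLp 2 (Fin k → ℝ)) := by fun_prop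
  rw [Measure.map_map hL hm, charFun_apply, integral_map (hL.comp hm).aemeasurable (by fun_prop)]
  have h1 := congrArg (fun μ => charFun μ 1) (hg (Aᵀ *ᵥ t.ofLp))
  rw [charFun_apply_real, integral_map (by fun_prop) (by fun_prop), charFun_gaussianReal] at h1
  have hq : ∑ j, ∑ l, (Aᵀ *ᵥ t.ofLp) j * S j l * (Aᵀ *ᵥ t.ofLp) l = ∑ i, t.ofLp i ^ 2 := by
    have : ∑ j, ∑ l, (Aᵀ *ᵥ t.ofLp) j * S j l * (Aᵀ *ᵥ t.ofLp) l
        = (Aᵀ *ᵥ t.ofLp) ⬝ᵥ (S *ᵥ (Aᵀ *ᵥ t.ofLp)) := by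
      simp only [dotProduct, mulVec, Finset.mul_sum, mul_assoc]
    rw [this, Matrix.mulVec_transpose A, ← Matrix.dotProduct_mulVec, ← Matrix.mulVec_transpose A,
      Matrix.mulVec_mulVec, Matrix.mulVec_mulVec, hA, Matrix.one_mulVec]
    simp [dotProduct, pow_two]
  rw [hq, Real.coe_toNNReal _ (by positivity)] at h1
  simp only [charFun_gaussianReal]
  rw [← Complex.exp_sum]
  convert h1 using 1
  · apply integral_congr_ae
    refine Filter.Eventually.of_forall fun ω => ?_
    simp only [Function.comp]
    congr 2
    have : inner ℝ (WithLp.toLp 2 (A *ᵥ X ω)) t = ∑ j, (Aᵀ *ᵥ t.ofLp) j * X ω j := by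
      rw [PiLp.inner_apply]
      change ∑ i, inner ℝ ((A *ᵥ X ω) i) (t.ofLp i) = (Aᵀ *ᵥ t.ofLp) ⬝ᵥ X ω
      rw [Matrix.mulVec_transpose A, ← Matrix.dotProduct_mulVec]
      simp [dotProduct]
    rw [this]; push_cast; ring
  · congr 1
    push_cast
    simp [Finset.sum_neg_distrib, Finset.sum_div]

lemma law_noise {Ω : Type*} [MeasurableSpace Ω] (P : Measure Ω) [IsProbabilityMeasure P] {k n : ℕ}
    (S A : Matrix (Fin k) (Fin k) ℝ) (hA : A * S * Aᵀ = 1) (X : Fin n → Ω → Fin k → ℝ)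
    (hX : ∀ i, Measurable (X i)) (hind : iIndepFun X P)
    (hg : ∀ i, ∀ u : Fin k → ℝ, Measure.map (fun ω => ∑ j, u j * X i ω j) P =
        gaussianReal 0 (Real.toNNReal (∑ j, ∑ l, u j * S j l * u l))) :
    Measure.map (fun ω (j : Fin k) (i : Fin n) => (A *ᵥ X i ω) j) P =
      Measure.pi fun _ : Fin k => gam (Fin n) := by
  have hc : Measurable fun x : Fin k → ℝ => A *ᵥ x := by
    have : Continuous fun x : Fin k → ℝ => A *ᵥ x := by fun_prop
    exact this.measurable
  have hm : ∀ i j, Measurable (fun ω => (A *ᵥ X i ω) j) := fun i j =>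
    (measurable_pi_apply j).comp (hc.comp (hX i))
  have h1 : iIndepFun (fun i ω => A *ᵥ X i ω) P := hind.comp (fun _ x => A *ᵥ x) (fun _ => hc)
  have hj : ∀ i j, Measure.map (fun ω => (A *ᵥ X i ω) j) P = gaussianReal 0 1 := by
    intro i j
    have := map_whiten P S A hA (X i) (hX i) (hg i)
    have h2 := congrArg (Measure.map (Function.eval j)) this
    rw [Measure.map_map (show Measurable (Function.eval j) from measurable_pi_apply j) (show Measurable (fun ω => A *ᵥ X i ω) from hc.comp (hX i))] at h2
    unfold gam at h2
    rw [(measurePreserving_eval (fun _ : Fin k => gaussianReal 0 1) j).map_eq] at h2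
    exact h2
  have h2 : ∀ i, iIndepFun (fun j ω => (A *ᵥ X i ω) j) P := by
    intro i
    rw [iIndepFun_iff_map_fun_eq_pi_map (fun j => (hm i j).aemeasurable)]
    simp only [hj]
    exact map_whiten P S A hA (X i) (hX i) (hg i)
  have h3 := iIndepFun_uncurry' (X := fun i j ω => (A *ᵥ X i ω) j) hm h1 h2
  have h4 : iIndepFun (fun (p : Fin k × Fin n) ω => (A *ᵥ X p.2 ω) p.1) P :=
    h3.precomp (g := fun p : Fin k × Fin n => (p.2, p.1)) (Equiv.prodComm (Fin k) (Fin n)).injective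
  rw [iIndepFun_iff_map_fun_eq_pi_map (f := fun (p : Fin k × Fin n) ω => (A *ᵥ X p.2 ω) p.1)
    (fun p => (hm p.2 p.1).aemeasurable)] at h4
  simp only [hj] at h4
  rw [← Measure.infinitePi_eq_pi] at h4
  have h5 := congrArg (Measure.map (MeasurableEquiv.curry (Fin k) (Fin n) ℝ)) h4
  rw [Measure.infinitePi_map_curry (fun _ _ => gaussianReal 0 1),
    Measure.map_map (MeasurableEquiv.measurable _) (show Measurable
      (fun ω (p : Fin k × Fin n) => (A *ᵥ X p.2 ω) p.1) from measurable_pi_lambda _ fun p => hm p.2 p.1)] at h5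
  simp only [Measure.infinitePi_eq_pi] at h5
  exact h5

end Wilks

namespace Wilks

noncomputable def pr {κ ι : Type*} [Fintype κ] [DecidableEq κ] [Fintype ι] [DecidableEq ι]
    (Z : Matrix κ ι ℝ) : Matrix ι ι ℝ := 1 - Zᵀ * (Z * Zᵀ)⁻¹ * Z

lemma unit_of_rank {κ ι : Type*} [Fintype κ] [DecidableEq κ] [Fintype ι] [DecidableEq ι]
    (Z : Matrix κ ι ℝ) (h : Z.rank = Fintype.card κ) : IsUnit (Z * Zᵀ).det := by
  have h2 : (Z * Zᵀ).rank = Fintype.card κ := by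
    rw [Matrix.rank_self_mul_transpose, h]
  rw [← Matrix.isUnit_iff_isUnit_det, ← Matrix.linearIndependent_rows_iff_isUnit,
    linearIndependent_iff_card_eq_finrank_span, ← h2, Matrix.rank_eq_finrank_span_row]
  rfl

lemma rank_sub {κ₁ κ₂ ι : Type*} [Fintype κ₁] [Fintype κ₂] [DecidableEq κ₁] [DecidableEq κ₂]
    [Fintype ι] [DecidableEq ι]
    (Z : Matrix (κ₁ ⊕ κ₂) ι ℝ) (h : Z.rank = Fintype.card (κ₁ ⊕ κ₂)) :
    (Z.submatrix Sum.inr id).rank = Fintype.card κ₂ := by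
  have h1 : LinearIndependent ℝ Z.row := by
    rw [linearIndependent_iff_card_eq_finrank_span, ← h, Matrix.rank_eq_finrank_span_row]
    rfl
  have h2 := h1.comp (Sum.inr : κ₂ → κ₁ ⊕ κ₂) Sum.inr_injective
  exact LinearIndependent.rank_matrix h2

section
variable {κ ι : Type*} [Fintype κ] [DecidableEq κ] [Fintype ι] [DecidableEq ι]
    (Z : Matrix κ ι ℝ)

lemma pr_symm : (pr Z)ᵀ = pr Z := by
  unfold pr
  simp [Matrix.transpose_sub, Matrix.transpose_mul, Matrix.transpose_nonsing_inv, Matrix.mul_assoc]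

lemma mul_pr (h : IsUnit (Z * Zᵀ).det) : Z * pr Z = 0 := by
  unfold pr
  rw [Matrix.mul_sub, Matrix.mul_one, ← Matrix.mul_assoc, ← Matrix.mul_assoc,
    Matrix.mul_nonsing_inv _ h, Matrix.one_mul, sub_self]

lemma pr_mul_of {Q : Matrix ι ι ℝ} (h : Z * Q = 0) : pr Z * Q = Q := by
  unfold pr
  rw [Matrix.sub_mul, Matrix.one_mul, Matrix.mul_assoc, h, Matrix.mul_zero, sub_zero]

lemma pr_idem (h : IsUnit (Z * Zᵀ).det) : pr Z * pr Z = pr Z := pr_mul_of Z (mul_pr Z h)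

lemma pr_trace (h : IsUnit (Z * Zᵀ).det) :
    (pr Z).trace = Fintype.card ι - Fintype.card κ := by
  unfold pr
  rw [Matrix.trace_sub, Matrix.trace_one, Matrix.trace_mul_comm, ← Matrix.mul_assoc,
    Matrix.mul_nonsing_inv _ h, Matrix.trace_one]

end

lemma sum_vmv {n : ℕ} {α β : Type*} [Fintype α] [Fintype β] (x : Fin n → α → ℝ) (z : Fin n → β → ℝ) :
    ∑ i, vecMulVec (x i) (z i)
      = (Matrix.of fun a i => x i a) * (Matrix.of fun b i => z i b)ᵀ := by
  ext a b
  simp [Matrix.sum_apply, vecMulVec_apply, Matrix.mul_apply]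

lemma resid {n k : ℕ} {κ : Type*} [Fintype κ] [DecidableEq κ] (z : Fin n → κ → ℝ)
    (Z : Matrix κ (Fin n) ℝ) (hZ : Z = Matrix.of fun a i => z i a)
    (hu : IsUnit (Z * Zᵀ).det) (B : Matrix (Fin k) κ ℝ) (e x : Fin n → Fin k → ℝ)
    (hx : ∀ i, x i = B *ᵥ z i + e i) (Bh : Matrix (Fin k) κ ℝ)
    (hB : Bh = (∑ i, vecMulVec (x i) (z i)) * (∑ i, vecMulVec (z i) (z i))⁻¹) :
    ∑ i, vecMulVec (x i - Bh *ᵥ z i) (x i - Bh *ᵥ z i) = Gr (pr Z) (fun j i => e i j) := by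
  rw [sum_vmv]
  rw [sum_vmv, sum_vmv, ← hZ] at hB
  have hX : (Matrix.of fun a i => x i a) = B * Z + Matrix.of fun a i => e i a := by
    ext a i
    simp [hx, hZ, mulVec, dotProduct, Matrix.mul_apply]
  have hR : (Matrix.of fun a i => (x i - Bh *ᵥ z i) a)
      = (Matrix.of fun a i => x i a) * pr Z := by
    have : (Matrix.of fun a i => (x i - Bh *ᵥ z i) a) = (Matrix.of fun a i => x i a) - Bh * Z := by
      ext a i
      simp [hZ, mulVec, dotProduct, Matrix.mul_apply]
    rw [this, hB]
    unfold pr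
    rw [Matrix.mul_sub, Matrix.mul_one]
    simp only [Matrix.mul_assoc]
  rw [hR, hX, Matrix.add_mul, Matrix.mul_assoc, mul_pr Z hu, Matrix.mul_zero, zero_add,
    Matrix.transpose_mul, pr_symm, Matrix.mul_assoc, ← Matrix.mul_assoc (pr Z), pr_idem Z hu]
  unfold Gr
  rw [Matrix.mul_assoc]

lemma Gr_whiten {n k : ℕ} (Q : Matrix (Fin n) (Fin n) ℝ) (A : Matrix (Fin k) (Fin k) ℝ)
    (e : Fin n → Fin k → ℝ) :
    (Gr Q (fun j i => (A *ᵥ e i) j)).det = A.det ^ 2 * (Gr Q (fun j i => e i j)).det := by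
  have : (Matrix.of fun j i => (A *ᵥ e i) j) = A * Matrix.of fun j i => e i j := by
    ext a i
    simp [mulVec, dotProduct, Matrix.mul_apply]
  unfold Gr
  rw [this, Matrix.transpose_mul]
  rw [show A * (Matrix.of fun j i => e i j) * Q * ((Matrix.of fun j i => e i j)ᵀ * Aᵀ)
    = A * ((Matrix.of fun j i => e i j) * Q * (Matrix.of fun j i => e i j)ᵀ) * Aᵀ by
      simp only [Matrix.mul_assoc]]
  rw [Matrix.det_mul, Matrix.det_mul A, Matrix.det_transpose]
  ring

end Wilks

namespace Wilks

lemma wilks_cf {n p q₁ q₂ : ℕ} {Ω : Type*} [MeasurableSpace Ω] (P : Measure Ω)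
    [IsProbabilityMeasure P] (B : Matrix (Fin p) (Fin q₁ ⊕ Fin q₂) ℝ) (Bs : Matrix (Fin p) (Fin q₁) ℝ)
    (z : Fin n → (Fin q₁ ⊕ Fin q₂) → ℝ) (Sig : Matrix (Fin p) (Fin p) ℝ)
    (ε : Fin n → Ω → (Fin p → ℝ)) (hmeas : ∀ i, Measurable (ε i)) (hS : Sig.PosDef)
    (hindep : iIndepFun ε P)
    (hgauss : ∀ (i : Fin n) (u : Fin p → ℝ),
      Measure.map (fun ω => ∑ j, u j * ε i ω j) P =
        gaussianReal 0 (Real.toNNReal (∑ j, ∑ l, u j * Sig j l * u l)))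
    (hrank : (Matrix.of fun (a : Fin q₁ ⊕ Fin q₂) (i : Fin n) => z i a).rank = q₁ + q₂)
    (hsize : p + (q₁ + q₂) ≤ n) (hnull : ∀ a j, B a (Sum.inl j) = Bs a j)
    (x yv : Fin n → Ω → (Fin p → ℝ)) (hx : ∀ i ω, x i ω = B *ᵥ z i + ε i ω)
    (hyv : ∀ i ω, yv i ω = x i ω - Bs *ᵥ (fun j => z i (Sum.inl j)))
    (Bh : Ω → Matrix (Fin p) (Fin q₁ ⊕ Fin q₂) ℝ)
    (hBh : ∀ ω, Bh ω = (∑ i, vecMulVec (x i ω) (z i)) * (∑ i, vecMulVec (z i) (z i))⁻¹)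
    (Bh2 : Ω → Matrix (Fin p) (Fin q₂) ℝ)
    (hBh2 : ∀ ω, Bh2 ω = (∑ i, vecMulVec (yv i ω) (fun j => z i (Sum.inr j))) *
      (∑ i, vecMulVec (fun j => z i (Sum.inr j)) (fun j => z i (Sum.inr j)))⁻¹)
    (Λ : Ω → ℝ)
    (hΛ : ∀ ω, Λ ω = ((n : ℝ)⁻¹ • ∑ i, vecMulVec (x i ω - Bh ω *ᵥ z i) (x i ω - Bh ω *ᵥ z i)).det /
      ((n : ℝ)⁻¹ • ∑ i, vecMulVec (yv i ω - Bh2 ω *ᵥ (fun j => z i (Sum.inr j)))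
        (yv i ω - Bh2 ω *ᵥ (fun j => z i (Sum.inr j)))).det) :
    Measurable Λ ∧ ∀ s : ℂ, s.re = 0 →
      ∫ ω, Complex.exp (s * (Real.log (Λ ω) : ℂ)) ∂P
        = ∏ j ∈ Finset.range p, K (n - (q₁ + q₂) - j) s / K (n - q₂ - j) s := by
  obtain ⟨A, hA0, hA⟩ := exists_whiten Sig hS
  set Z : Matrix (Fin q₁ ⊕ Fin q₂) (Fin n) ℝ := Matrix.of fun a i => z i a with hZ
  set Z₂ : Matrix (Fin q₂) (Fin n) ℝ := Z.submatrix Sum.inr id with hZ₂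
  have hr1 : Z.rank = Fintype.card (Fin q₁ ⊕ Fin q₂) := by rw [hrank]; simp
  have hu1 := unit_of_rank Z hr1
  have hu2 : IsUnit (Z₂ * Z₂ᵀ).det := unit_of_rank _ (rank_sub Z hr1)
  set W : Ω → Fin p → Fin n → ℝ := fun ω j i => (A *ᵥ ε i ω) j with hW
  have hlaw := law_noise P Sig A hA ε hmeas hindep hgauss
  have hWm : Measurable W := by
    refine measurable_pi_lambda _ fun j => measurable_pi_lambda _ fun i => ?_
    have : Continuous fun v : Fin p → ℝ => (A *ᵥ v) j := by fun_prop
    exact this.measurable.comp (hmeas i)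
  have key : ∀ ω, Λ ω = (Gr (pr Z) (W ω)).det / (Gr (pr Z₂) (W ω)).det := by
    intro ω
    rw [hΛ, resid z Z hZ hu1 B (fun i => ε i ω) (fun i => x i ω) (fun i => hx i ω) (Bh ω) (hBh ω),
      resid (fun i j => z i (Sum.inr j)) Z₂ rfl hu2 (Matrix.of fun a j => B a (Sum.inr j))
        (fun i => ε i ω) (fun i => yv i ω) ?_ (Bh2 ω) (hBh2 ω), hW]
    · rw [Gr_whiten, Gr_whiten, Matrix.det_smul, Matrix.det_smul, mul_div_mul_left, mul_div_mul_left]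
      · exact pow_ne_zero _ hA0
      · simp only [Fintype.card_fin]
        rcases Nat.eq_zero_or_pos n with h | h
        · have : p = 0 := by omega
          rw [this]; simp
        · positivity
    · intro i
      simp only [hyv, hx]
      ext a
      simp [mulVec, dotProduct, Fintype.sum_sum_type, hnull]
      ring
  have hcast1 : (pr Z).trace = ((n - (q₁ + q₂) : ℕ) : ℝ) := by
    rw [pr_trace Z hu1, Nat.cast_sub (by omega)]; simp
  have hcast2 : (pr Z₂).trace = ((n - q₂ : ℕ) : ℝ) := by
    rw [pr_trace Z₂ hu2, Nat.cast_sub (by omega)]; simp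
  have h01 : pr Z₂ * pr Z = pr Z := by
    apply pr_mul_of
    have := mul_pr Z hu1
    have h2 : Z₂ * pr Z = (Z * pr Z).submatrix Sum.inr id := by
      rw [hZ₂]; ext a b; simp [Matrix.mul_apply]
    rw [h2, this]; rfl
  constructor
  · have : Λ = (fun V => (Gr (pr Z) V).det / (Gr (pr Z₂) V).det) ∘ W := funext key
    rw [this]
    exact ((meas_Gr _).div (meas_Gr _)).comp hWm
  · intro s hs
    have h := (gram_law (pr Z) (pr Z₂) (pr_symm Z) (pr_symm Z₂) (pr_idem Z hu1) (pr_idem Z₂ hu2) h01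
      _ _ hcast1 hcast2 (by omega) s hs p (by omega)).2
    rw [← h, ← hlaw, integral_map hWm.aemeasurable]
    · simp only [key]
    · refine Measurable.aestronglyMeasurable ?_
      have h1 : Measurable fun V : Fin p → Fin n → ℝ => (Gr (pr Z) V).det := meas_Gr _
      have h2 : Measurable fun V : Fin p → Fin n → ℝ => (Gr (pr Z₂) V).det := meas_Gr _
      fun_prop
end Wilks

namespace Wilks

noncomputable def ff (s : ℂ) (x : ℝ) : ℂ :=
  Complex.Gamma (x + s) / Complex.Gamma x * Complex.exp (-(s * (Real.log x : ℂ)) - s * (s - 1) / (2 * x))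

noncomputable def dd (s : ℂ) (x : ℝ) : ℂ :=
  Complex.log (1 + s / x) - s * (Real.log (1 + 1 / x) : ℂ) + s * (s - 1) / 2 * (1 / x - 1 / (x + 1))

lemma ne_of_re_pos {z : ℂ} (h : 0 < z.re) : z ≠ 0 := by
  rintro rfl; simp at h

lemma ff_succ (s : ℂ) (hs : s.re = 0) (x : ℝ) (hx : 0 < x) :
    ff s (x + 1) = ff s x * Complex.exp (dd s x) := by
  have h1 : ((x : ℂ) + s) ≠ 0 := ne_of_re_pos (by simp [hs, hx])
  have h2 : (x : ℂ) ≠ 0 := ne_of_re_pos (by simp [hx])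
  have h2' : (x : ℂ) + 1 ≠ 0 := ne_of_re_pos (by simp; linarith)
  have h3 : (1 + s / x : ℂ) ≠ 0 := by
    intro h; apply h1; field_simp at h; simpa using h
  have hG : Complex.Gamma x ≠ 0 := Complex.Gamma_ne_zero_of_re_pos (by simpa using hx)
  unfold ff dd
  push_cast
  rw [show ((x : ℂ) + 1 + s) = (x + s) + 1 by ring, Complex.Gamma_add_one _ h1,
    Complex.Gamma_add_one _ h2]
  have hl : Real.log (1 + 1 / x) = Real.log (x + 1) - Real.log x := by
    rw [← Real.log_div (by linarith) (by linarith)]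
    congr 1; field_simp
  have hl' : (((Real.log (x+1) : ℝ)) : ℂ) = (Real.log (1 + 1/x) : ℂ) + (Real.log x : ℂ) := by
    rw [hl]; push_cast; ring
  rw [hl', mul_assoc, ← Complex.exp_add]
  rw [show -(s * ↑(Real.log x)) - s * (s - 1) / (2 * ↑x) + (Complex.log (1 + s / ↑x) - s * ↑(Real.log (1 + 1 / x)) +
      s * (s - 1) / 2 * (1 / ↑x - 1 / (↑x + 1))) = Complex.log (1 + s / ↑x) + (-(s * (↑(Real.log (1 + 1 / x)) + ↑(Real.log x))) - s * (s - 1) / (2 * (↑x + 1))) by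
    field_simp; ring]
  rw [Complex.exp_add, Complex.exp_log h3]
  field_simp

lemma dd_bound (s : ℂ) : ∃ C : ℝ, 0 < C ∧ ∀ x : ℝ, 2 ≤ x → 2 * ‖s‖ ≤ x → ‖dd s x‖ ≤ C / x ^ 3 := by
  refine ⟨‖s‖ ^ 3 + ‖s‖ + ‖s * (s - 1) / 2‖ + 1, by positivity, fun x hx hsx => ?_⟩
  have hx0 : 0 < x := by linarith
  have key : ∀ w : ℂ, ‖w‖ ≤ 1 / 2 → ‖Complex.log (1 + w) - (w - w ^ 2 / 2)‖ ≤ ‖w‖ ^ 3 := by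
    intro w hw
    have h := Complex.norm_log_sub_logTaylor_le 2 (z := w) (by linarith)
    have ht : Complex.logTaylor (2 + 1) w = w - w ^ 2 / 2 := by
      simp [Complex.logTaylor_succ, Complex.logTaylor_zero]
      ring
    rw [ht] at h
    refine h.trans ?_
    have : (1 - ‖w‖)⁻¹ ≤ 2 := by
      rw [inv_le_comm₀ (by linarith) (by norm_num)]; linarith
    have h3 : 0 ≤ ‖w‖ ^ 3 := by positivity
    norm_num
    nlinarith
  have hxc : (x : ℂ) ≠ 0 := by exact_mod_cast hx0.ne'
  have hxc1 : (x : ℂ) + 1 ≠ 0 := by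
    have : x + 1 ≠ 0 := by linarith
    exact_mod_cast this
  have k1 := key (s / x) (by
    rw [norm_div, Complex.norm_real, Real.norm_of_nonneg hx0.le, div_le_iff₀ hx0]; linarith)
  have k2 := key (((1 / x : ℝ)) : ℂ) (by
    rw [Complex.norm_real, Real.norm_of_nonneg (by positivity)]
    exact one_div_le_one_div_of_le (by norm_num) hx)
  have hlog : Complex.log (1 + ((1 / x : ℝ) : ℂ)) = (Real.log (1 + 1 / x) : ℂ) := by
    rw [Complex.ofReal_log (by positivity)]; push_cast; rfl
  rw [hlog] at k2
  have hd : dd s x = (Complex.log (1 + s / x) - (s / x - (s / x) ^ 2 / 2))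
      - s * ((Real.log (1 + 1 / x) : ℂ) - (((1 / x : ℝ) : ℂ) - ((1 / x : ℝ) : ℂ) ^ 2 / 2))
      - s * (s - 1) / 2 * ((1 / (x ^ 2 * (x + 1)) : ℝ) : ℂ) := by
    unfold dd
    push_cast
    field_simp
    ring
  rw [hd]
  refine (norm_sub_le _ _).trans ?_
  refine (add_le_add_left (norm_sub_le _ _) _).trans ?_
  rw [norm_mul s, norm_mul (s * (s - 1) / 2)]
  have e1 : ‖s / (x : ℂ)‖ ^ 3 = ‖s‖ ^ 3 / x ^ 3 := by
    rw [norm_div, Complex.norm_real, Real.norm_of_nonneg hx0.le, div_pow]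
  have e2 : ‖((1 / x : ℝ) : ℂ)‖ ^ 3 = 1 / x ^ 3 := by
    rw [Complex.norm_real, Real.norm_of_nonneg (by positivity), div_pow, one_pow]
  have e3 : ‖((1 / (x ^ 2 * (x + 1)) : ℝ) : ℂ)‖ ≤ 1 / x ^ 3 := by
    rw [Complex.norm_real, Real.norm_of_nonneg (by positivity)]
    apply one_div_le_one_div_of_le (by positivity)
    nlinarith [sq_nonneg x]
  rw [e1] at k1
  rw [e2] at k2
  calc _ ≤ ‖s‖ ^ 3 / x ^ 3 + ‖s‖ * (1 / x ^ 3) + ‖s * (s - 1) / 2‖ * (1 / x ^ 3) := by gcongr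
    _ ≤ _ := by
      rw [add_div, add_div, add_div]
      have : 0 < 1 / x ^ 3 := by positivity
      have a : ‖s‖ * (1 / x ^ 3) = ‖s‖ / x ^ 3 := by ring
      have b : ‖s * (s - 1) / 2‖ * (1 / x ^ 3) = ‖s * (s - 1) / 2‖ / x ^ 3 := by ring
      linarith

lemma ff_iter (s : ℂ) (hs : s.re = 0) (x : ℝ) (hx : 0 < x) (m : ℕ) :
    ff s (x + m) = ff s x * Complex.exp (∑ k ∈ Finset.range m, dd s (x + k)) := by
  induction m with
  | zero => simp
  | succ m ih =>
    rw [Finset.sum_range_succ, Complex.exp_add, ← mul_assoc, ← ih, ← ff_succ s hs _ (by positivity)]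
    congr 1; push_cast; ring

lemma sum_cube (x : ℝ) (hx : 2 ≤ x) (m : ℕ) :
    ∑ k ∈ Finset.range m, 1 / (x + k) ^ 3 ≤ 4 / x ^ 2 := by
  have h : ∀ m : ℕ, ∑ k ∈ Finset.range m, 1 / (x + k) ^ 3 ≤ 1 / (x - 1) ^ 2 - 1 / (x - 1 + m) ^ 2 := by
    intro m
    induction m with
    | zero => simp
    | succ m ih =>
      rw [Finset.sum_range_succ]
      have hm : (0 : ℝ) ≤ m := Nat.cast_nonneg m
      have : 1 / (x + m) ^ 3 ≤ 1 / (x - 1 + m) ^ 2 - 1 / (x - 1 + (m + 1 : ℕ)) ^ 2 := by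
        push_cast
        set u := x - 1 + m with hu
        have hu1 : 1 ≤ u := by linarith
        rw [show x + m = u + 1 by rw [hu]; ring, show x - 1 + (m + 1 : ℝ) = u + 1 by rw [hu]; ring]
        rw [div_sub_div _ _ (by positivity) (by positivity), div_le_div_iff₀ (by positivity) (by positivity)]
        have h1 : 0 < (u + 1) ^ 2 := by positivity
        have h2 : u ^ 2 ≤ (1 * (u + 1) ^ 2 - u ^ 2 * 1) * (u + 1) := by nlinarith
        nlinarith [mul_le_mul_of_nonneg_left h2 h1.le]
      linarith
  refine (h m).trans ?_
  have h2 : 0 ≤ 1 / (x - 1 + m) ^ 2 := by positivity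
  have h3 : 1 / (x - 1) ^ 2 ≤ 4 / x ^ 2 := by
    have : 0 < x - 1 := by linarith
    rw [div_le_div_iff₀ (by positivity) (by positivity)]
    nlinarith
  linarith

lemma Gamma_prod (w : ℂ) (hw : 0 < w.re) (m : ℕ) :
    Complex.Gamma (w + m) = (∏ j ∈ Finset.range m, (w + j)) * Complex.Gamma w := by
  induction m with
  | zero => simp
  | succ m ih =>
    rw [Finset.prod_range_succ, mul_right_comm, ← ih]
    push_cast
    rw [← add_assoc, Complex.Gamma_add_one _ (ne_of_re_pos (by simp; positivity)), mul_comm]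

lemma ff_lim (s : ℂ) (hs : s.re = 0) (x : ℝ) (hx : 0 < x) :
    Tendsto (fun m : ℕ => ff s (x + (m + 1 : ℕ))) atTop (nhds 1) := by
  have hxr : 0 < (x : ℂ).re := by simpa using hx
  have hxs : 0 < ((x : ℂ) + s).re := by simp [hs, hx]
  have hG1 := Complex.Gamma_ne_zero_of_re_pos hxr
  have hG2 := Complex.Gamma_ne_zero_of_re_pos hxs
  have h1 := ((Complex.GammaSeq_tendsto_Gamma (x : ℂ)).div (Complex.GammaSeq_tendsto_Gamma (x + s)) hG2).mul_const
    (Complex.Gamma (x + s) / Complex.Gamma x)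
  rw [show Complex.Gamma x / Complex.Gamma (x + s) * (Complex.Gamma (x + s) / Complex.Gamma x) = 1 by
    field_simp] at h1
  have h2 : Tendsto (fun m : ℕ => Complex.exp (-(s * ((Real.log (x + (m + 1 : ℕ)) - Real.log m : ℝ) : ℂ))
      - s * (s - 1) / 2 * (((x + (m + 1 : ℕ))⁻¹ : ℝ) : ℂ))) atTop (nhds 1) := by
    have a1 : Tendsto (fun m : ℕ => Real.log (x + (m + 1 : ℕ)) - Real.log m) atTop (nhds 0) := by
      have b : Tendsto (fun m : ℕ => Real.log ((x + 1) * (m : ℝ)⁻¹ + 1)) atTop (nhds 0) := by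
        have c : Tendsto (fun m : ℕ => (x + 1) * (m : ℝ)⁻¹ + 1) atTop (nhds 1) := by
          have := ((tendsto_inv_atTop_nhds_zero_nat (𝕜 := ℝ)).const_mul (x + 1)).add_const 1
          simpa [Function.comp_def] using this
        have := (Real.continuousAt_log one_ne_zero).tendsto.comp c
        simpa [Function.comp_def] using this
      refine b.congr' ?_
      filter_upwards [eventually_gt_atTop 0] with m hm
      have hm' : (0 : ℝ) < m := by exact_mod_cast hm
      rw [← Real.log_div (by positivity) (by positivity)]
      congr 1
      push_cast
      field_simp
      ring
    have a2 : Tendsto (fun m : ℕ => (x + (m + 1 : ℕ))⁻¹) atTop (nhds 0) := by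
      apply tendsto_inv_atTop_zero.comp
      apply tendsto_atTop_add_const_left
      exact (tendsto_natCast_atTop_atTop (R := ℝ)).comp (tendsto_add_atTop_nat 1)
    have a1' := (Complex.continuous_ofReal.tendsto 0).comp a1
    have a2' := (Complex.continuous_ofReal.tendsto 0).comp a2
    have := ((a1'.const_mul s).neg).sub (a2'.const_mul (s * (s - 1) / 2))
    have := (Complex.continuous_exp.tendsto _).comp this
    simpa [Function.comp_def] using this
  have h3 := h1.mul h2
  rw [one_mul] at h3
  refine h3.congr' ?_
  filter_upwards [eventually_gt_atTop 0] with m hm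
  have hm' : (0 : ℝ) < m := by exact_mod_cast hm
  have hmc : (m : ℂ) ≠ 0 := by exact_mod_cast hm.ne'
  unfold ff
  have e1 := Gamma_prod (x : ℂ) hxr (m + 1)
  have e2 := Gamma_prod ((x : ℂ) + s) hxs (m + 1)
  have p1 : (∏ j ∈ Finset.range (m + 1), ((x : ℂ) + j)) ≠ 0 :=
    Finset.prod_ne_zero_iff.mpr fun j _ => ne_of_re_pos (by simp; positivity)
  have p2 : (∏ j ∈ Finset.range (m + 1), ((x : ℂ) + s + j)) ≠ 0 :=
    Finset.prod_ne_zero_iff.mpr fun j _ => ne_of_re_pos (by simp [hs]; positivity)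
  have e3 : Complex.exp (-(s * (Real.log (x + (m + 1 : ℕ)) : ℂ)) - s * (s - 1) / (2 * ((x + (m + 1 : ℕ) : ℝ) : ℂ)))
      = (m : ℂ) ^ (-s) * Complex.exp (-(s * ((Real.log (x + (m + 1 : ℕ)) - Real.log m : ℝ) : ℂ))
      - s * (s - 1) / 2 * (((x + (m + 1 : ℕ))⁻¹ : ℝ) : ℂ)) := by
    rw [Complex.cpow_def_of_ne_zero hmc, ← Complex.natCast_log, ← Complex.exp_add]
    congr 1
    push_cast
    rw [div_eq_mul_inv, mul_inv]
    ring
  rw [e3, show (((x + (m + 1 : ℕ) : ℝ) : ℂ) + s) = (x : ℂ) + s + ((m + 1 : ℕ) : ℂ) by push_cast; ring, e2,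
    show ((x + (m + 1 : ℕ) : ℝ) : ℂ) = (x : ℂ) + ((m + 1 : ℕ) : ℂ) by push_cast; ring, e1]
  simp only [Pi.div_apply, Complex.GammaSeq]
  rw [Complex.cpow_add _ _ hmc, Complex.cpow_neg]
  have c1 : (m : ℂ) ^ s ≠ 0 := by simp [Complex.cpow_def, hmc]
  have c2 : (m : ℂ) ^ (x : ℂ) ≠ 0 := by simp [Complex.cpow_def, hmc]
  have c3 : (m.factorial : ℂ) ≠ 0 := by exact_mod_cast m.factorial_ne_zero
  field_simp

lemma gamma_ratio (s : ℂ) (hs : s.re = 0) : ∃ C x₀ : ℝ, 0 < C ∧ 0 < x₀ ∧ ∀ x : ℝ, x₀ ≤ x →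
    ∃ δ : ℂ, ‖δ‖ ≤ C / x ^ 2 ∧ Complex.Gamma (x + s) / Complex.Gamma x =
      Complex.exp (s * (Real.log x : ℂ) + s * (s - 1) / (2 * x) + δ) := by
  obtain ⟨C, hC, hb⟩ := dd_bound s
  refine ⟨12 * C, 2 + 2 * ‖s‖ + 16 * C, by positivity, by positivity, fun x hx => ?_⟩
  have hs0 := norm_nonneg s
  have hx2 : 2 ≤ x := by linarith
  have hx0 : 0 < x := by linarith
  have hD : ∀ m : ℕ, ‖∑ k ∈ Finset.range m, dd s (x + k)‖ ≤ 4 * C / x ^ 2 := by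
    intro m
    calc _ ≤ ∑ k ∈ Finset.range m, ‖dd s (x + k)‖ := norm_sum_le _ _
      _ ≤ ∑ k ∈ Finset.range m, C * (1 / (x + k) ^ 3) := by
        apply Finset.sum_le_sum
        intro k _
        have : (0 : ℝ) ≤ k := Nat.cast_nonneg k
        refine (hb (x + k) (by linarith) (by linarith)).trans (le_of_eq (by ring))
      _ ≤ C * (4 / x ^ 2) := by
        rw [← Finset.mul_sum]
        exact mul_le_mul_of_nonneg_left (sum_cube x hx2 m) hC.le
      _ = _ := by ring
  have hsm : 16 * C / x ^ 2 ≤ 1 := by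
    rw [div_le_one (by positivity)]
    nlinarith
  have hsm' : 4 * C / x ^ 2 ≤ 1 / 4 := by
    have : 4 * C / x ^ 2 = (16 * C / x ^ 2) / 4 := by ring
    linarith
  have hf : ‖ff s x - 1‖ ≤ 8 * C / x ^ 2 := by
    have hl := ff_lim s hs x hx0
    have h1 : Tendsto (fun m : ℕ => ‖ff s x - ff s (x + (m + 1 : ℕ))‖) atTop (nhds ‖ff s x - 1‖) :=
      (tendsto_const_nhds.sub hl).norm
    have h2 : Tendsto (fun m : ℕ => ‖ff s (x + (m + 1 : ℕ))‖ * (8 * C / x ^ 2)) atTop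
        (nhds (‖(1 : ℂ)‖ * (8 * C / x ^ 2))) := hl.norm.mul_const _
    rw [norm_one, one_mul] at h2
    refine le_of_tendsto_of_tendsto' h1 h2 fun m => ?_
    have hi := ff_iter s hs x hx0 (m + 1)
    set D := ∑ k ∈ Finset.range (m + 1), dd s (x + k) with hDdef
    have hDm : ‖D‖ ≤ 4 * C / x ^ 2 := hD (m + 1)
    have : ff s x - ff s (x + (m + 1 : ℕ)) = ff s (x + (m + 1 : ℕ)) * (Complex.exp (-D) - 1) := by
      rw [hi, mul_sub, mul_assoc, ← Complex.exp_add]; simp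
    rw [this, norm_mul]
    apply mul_le_mul_of_nonneg_left _ (norm_nonneg _)
    refine (Complex.norm_exp_sub_one_le (by rw [norm_neg]; linarith)).trans ?_
    rw [norm_neg]
    have : 8 * C / x ^ 2 = 2 * (4 * C / x ^ 2) := by ring
    linarith
  have hhalf : ‖ff s x - 1‖ ≤ 1 / 2 := by
    have : 8 * C / x ^ 2 = (16 * C / x ^ 2) / 2 := by ring
    linarith
  have hne : ff s x ≠ 0 := by
    intro h; rw [h] at hhalf; norm_num at hhalf
  refine ⟨Complex.log (ff s x), ?_, ?_⟩
  · have := Complex.norm_log_one_add_half_le_self hhalf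
    rw [add_sub_cancel] at this
    have e : 12 * C / x ^ 2 = 3 / 2 * (8 * C / x ^ 2) := by ring
    linarith
  · rw [Complex.exp_add, Complex.exp_log hne]
    unfold ff
    rw [mul_comm, mul_assoc, ← Complex.exp_add]
    simp
end Wilks

namespace Wilks

lemma K_asym (s : ℂ) (hs : s.re = 0) : ∃ (C : ℝ) (d₀ : ℕ) (δ : ℕ → ℂ), 0 < C ∧ ∀ d : ℕ, d₀ < d →
    ‖δ d‖ ≤ C / (d : ℝ) ^ 2 ∧
    K d s = Complex.exp (s * (Real.log d : ℂ) + s * (s - 1) * ((d : ℝ)⁻¹ : ℝ) + δ d) := by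
  obtain ⟨C, x₀, hC, hx₀, h⟩ := gamma_ratio s hs
  obtain ⟨d₀, hd₀⟩ := exists_nat_ge (2 * x₀)
  have h' : ∀ d : ℕ, ∃ δ : ℂ, d₀ < d → ‖δ‖ ≤ 4 * C / (d : ℝ) ^ 2 ∧
    K d s = Complex.exp (s * (Real.log d : ℂ) + s * (s - 1) * ((d : ℝ)⁻¹ : ℝ) + δ) := by
    intro d
    by_cases hd : d₀ < d
    · have hd' : (d₀ : ℝ) < d := by exact_mod_cast hd
      have hdp : (0 : ℝ) < d := by linarith
      obtain ⟨δ, h1, h2⟩ := h ((d : ℝ) / 2) (by linarith)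
      refine ⟨δ, fun _ => ⟨h1.trans (le_of_eq (by field_simp; ring)), ?_⟩⟩
      unfold K
      push_cast at h2
      rw [mul_div_assoc, h2, Complex.cpow_def_of_ne_zero two_ne_zero, ← Complex.exp_add]
      congr 1
      have hl : Real.log ((d : ℝ) / 2) = Real.log d - Real.log 2 := Real.log_div hdp.ne' two_ne_zero
      have hl2 : Complex.log 2 = (Real.log 2 : ℂ) := by
        rw [Complex.ofReal_log (by norm_num)]; norm_num
      rw [hl, hl2]
      push_cast
      have : (d : ℂ) ≠ 0 := by exact_mod_cast hdp.ne'
      field_simp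
      ring
    · exact ⟨0, fun h => absurd h hd⟩
  choose δ hδ using h'
  exact ⟨4 * C, d₀, δ, by positivity, hδ⟩

lemma sum_log (N p : ℕ) (h : p ≤ N) : ∑ j ∈ Finset.range p, Real.log ((N - j : ℕ) : ℝ)
    = Real.log (N.factorial) - Real.log ((N - p).factorial) := by
  induction p with
  | zero => simp
  | succ p ih =>
    rw [Finset.sum_range_succ, ih (by omega)]
    obtain ⟨k, hk⟩ : ∃ k, N = p + 1 + k := ⟨N - (p + 1), by omega⟩
    rw [show N - p = k + 1 by omega, show N - (p + 1) = k by omega, Nat.factorial_succ]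
    push_cast
    rw [Real.log_mul (by positivity) (by positivity)]
    ring

lemma sum_inv (N p : ℕ) (h : p ≤ N) : ∑ j ∈ Finset.range p, ((N - j : ℕ) : ℝ)⁻¹
    = (harmonic N : ℝ) - (harmonic (N - p) : ℝ) := by
  induction p with
  | zero => simp
  | succ p ih =>
    rw [Finset.sum_range_succ, ih (by omega)]
    obtain ⟨k, hk⟩ : ∃ k, N = p + 1 + k := ⟨N - (p + 1), by omega⟩
    rw [show N - p = k + 1 by omega, show N - (p + 1) = k by omega, harmonic_succ]
    push_cast
    ring

lemma log_fact (N : ℕ) (h : 0 < N) : Real.log (N.factorial) =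
    Real.log (Stirling.stirlingSeq N) + 1 / 2 * Real.log 2 + 1 / 2 * Real.log N + N * Real.log N - N := by
  have hN : (0 : ℝ) < N := by exact_mod_cast h
  rw [Stirling.log_stirlingSeq_formula, Real.log_mul two_ne_zero hN.ne',
    Real.log_div hN.ne' (Real.exp_pos 1).ne', Real.log_exp]
  ring

lemma st_lim : Tendsto (fun N => Real.log (Stirling.stirlingSeq N)) atTop (nhds (Real.log (√π))) :=
  ((Real.continuousAt_log (by positivity)).tendsto).comp Stirling.tendsto_stirlingSeq_sqrt_pi

/-- the entropy-like term -/
noncomputable def GG (p N M : ℕ) : ℝ :=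
  M * Real.log M - ((M - p : ℕ) : ℝ) * Real.log ((M - p : ℕ) : ℝ)
    - N * Real.log N + ((N - p : ℕ) : ℝ) * Real.log ((N - p : ℕ) : ℝ)

lemma sumL_lim (p N M : ℕ → ℕ) (hpN : ∀ n, p n ≤ N n) (hNM : ∀ n, N n ≤ M n)
    (hinf : Tendsto (fun n => N n - p n) atTop atTop) (w : ℝ)
    (hw : Tendsto (fun n => (Real.log (N n) - Real.log ((N n - p n : ℕ) : ℝ))
      - (Real.log (M n) - Real.log ((M n - p n : ℕ) : ℝ))) atTop (nhds w)) :
    Tendsto (fun n => GG (p n) (N n) (M n) + ∑ j ∈ Finset.range (p n), Real.log ((N n - j : ℕ) : ℝ)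
      - ∑ j ∈ Finset.range (p n), Real.log ((M n - j : ℕ) : ℝ)) atTop (nhds (w / 2)) := by
  have i2 : Tendsto N atTop atTop := tendsto_atTop_mono (fun n => Nat.sub_le _ _) hinf
  have i3 : Tendsto M atTop atTop := tendsto_atTop_mono hNM i2
  have i4 : Tendsto (fun n => M n - p n) atTop atTop :=
    tendsto_atTop_mono (fun n => Nat.sub_le_sub_right (hNM n) _) hinf
  have h := ((((st_lim.comp i2).sub (st_lim.comp hinf)).sub (st_lim.comp i3)).add (st_lim.comp i4)).add
    (hw.div_const 2)
  rw [show Real.log (√π) - Real.log (√π) - Real.log (√π) + Real.log (√π) + w / 2 = w / 2 by ring] at h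
  refine h.congr' ?_
  filter_upwards [hinf.eventually_gt_atTop 0] with n hn
  have h1 := hpN n
  have h2 := hNM n
  rw [sum_log _ _ h1, sum_log _ _ (h1.trans h2), log_fact _ hn, log_fact (N n) (by omega),
    log_fact (M n) (by omega), log_fact (M n - p n) (by omega)]
  unfold GG
  simp only [Function.comp]
  rw [Nat.cast_sub h1, Nat.cast_sub (h1.trans h2)]
  ring

lemma sumH_lim (p N M : ℕ → ℕ) (hpN : ∀ n, p n ≤ N n) (hNM : ∀ n, N n ≤ M n)
    (hinf : Tendsto (fun n => N n - p n) atTop atTop) (w : ℝ)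
    (hw : Tendsto (fun n => (Real.log (N n) - Real.log ((N n - p n : ℕ) : ℝ))
      - (Real.log (M n) - Real.log ((M n - p n : ℕ) : ℝ))) atTop (nhds w)) :
    Tendsto (fun n => ∑ j ∈ Finset.range (p n), ((N n - j : ℕ) : ℝ)⁻¹
      - ∑ j ∈ Finset.range (p n), ((M n - j : ℕ) : ℝ)⁻¹) atTop (nhds w) := by
  have i2 : Tendsto N atTop atTop := tendsto_atTop_mono (fun n => Nat.sub_le _ _) hinf
  have i3 : Tendsto M atTop atTop := tendsto_atTop_mono hNM i2
  have i4 : Tendsto (fun n => M n - p n) atTop atTop :=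
    tendsto_atTop_mono (fun n => Nat.sub_le_sub_right (hNM n) _) hinf
  have H := Real.tendsto_harmonic_sub_log
  have h := ((((H.comp i2).sub (H.comp hinf)).sub (H.comp i3)).add (H.comp i4)).add hw
  rw [sub_self, zero_sub, neg_add_cancel, zero_add] at h
  refine h.congr fun n => ?_
  have h1 := hpN n
  have h2 := hNM n
  rw [sum_inv _ _ h1, sum_inv _ _ (h1.trans h2)]
  simp only [Function.comp]
  ring

lemma prod_lim (p N M : ℕ → ℕ) (hpN : ∀ n, p n ≤ N n) (hNM : ∀ n, N n ≤ M n)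
    (hinf : Tendsto (fun n => N n - p n) atTop atTop) (w : ℝ)
    (hw : Tendsto (fun n => (Real.log (N n) - Real.log ((N n - p n : ℕ) : ℝ))
      - (Real.log (M n) - Real.log ((M n - p n : ℕ) : ℝ))) atTop (nhds w))
    (hsq : Tendsto (fun n => (p n : ℝ) / ((N n - p n : ℕ) : ℝ) ^ 2) atTop (nhds 0))
    (s : ℂ) (hs : s.re = 0) :
    Tendsto (fun n => Complex.exp (s * (GG (p n) (N n) (M n) : ℂ)) *
      ∏ j ∈ Finset.range (p n), K (N n - j) s / K (M n - j) s) atTop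
      (nhds (Complex.exp (s * (w / 2 : ℝ) + s * (s - 1) * w))) := by
  obtain ⟨C, d₀, δ, hC, hδ⟩ := K_asym s hs
  have hΔ : Tendsto (fun n => ∑ j ∈ Finset.range (p n), (δ (N n - j) - δ (M n - j))) atTop (nhds 0) := by
    rw [tendsto_zero_iff_norm_tendsto_zero]
    have hz := hsq.mul_const (2 * C)
    rw [zero_mul] at hz
    refine squeeze_zero' (Eventually.of_forall fun n => norm_nonneg _) ?_ hz
    filter_upwards [hinf.eventually_gt_atTop d₀] with n hn
    have hb : ∀ d : ℕ, N n - p n ≤ d → ‖δ d‖ ≤ C / ((N n - p n : ℕ) : ℝ) ^ 2 := by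
      intro d hd
      refine (hδ d (by omega)).1.trans ?_
      have : (0 : ℝ) < ((N n - p n : ℕ) : ℝ) := by exact_mod_cast (by omega : 0 < N n - p n)
      have hd' : ((N n - p n : ℕ) : ℝ) ≤ d := by exact_mod_cast hd
      gcongr
    calc _ ≤ ∑ j ∈ Finset.range (p n), ‖δ (N n - j) - δ (M n - j)‖ := norm_sum_le _ _
      _ ≤ ∑ j ∈ Finset.range (p n), (2 * (C / ((N n - p n : ℕ) : ℝ) ^ 2)) := by
        apply Finset.sum_le_sum
        intro j hj
        rw [Finset.mem_range] at hj
        have h2 := hNM n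
        refine (norm_sub_le _ _).trans ?_
        have a := hb (N n - j) (by omega)
        have b := hb (M n - j) (by omega)
        linarith
      _ = _ := by
        rw [Finset.sum_const, Finset.card_range, nsmul_eq_mul]; ring
  have hL := (Complex.continuous_ofReal.tendsto _).comp (sumL_lim p N M hpN hNM hinf w hw)
  have hH := (Complex.continuous_ofReal.tendsto _).comp (sumH_lim p N M hpN hNM hinf w hw)
  have hE := ((hL.const_mul s).add (hH.const_mul (s * (s - 1)))).add hΔ
  rw [add_zero] at hE
  refine ((Complex.continuous_exp.tendsto _).comp hE).congr' ?_
  filter_upwards [hinf.eventually_gt_atTop d₀] with n hn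
  have hprod : ∏ j ∈ Finset.range (p n), K (N n - j) s / K (M n - j) s
      = ∏ j ∈ Finset.range (p n), Complex.exp (
        s * ((Real.log ((N n - j : ℕ) : ℝ) : ℂ) - (Real.log ((M n - j : ℕ) : ℝ) : ℂ))
        + s * (s - 1) * (((((N n - j : ℕ) : ℝ)⁻¹ : ℝ) : ℂ) - ((((M n - j : ℕ) : ℝ)⁻¹ : ℝ) : ℂ))
        + (δ (N n - j) - δ (M n - j))) := by
    apply Finset.prod_congr rfl
    intro j hj
    rw [Finset.mem_range] at hj
    have h2 := hNM n
    rw [(hδ (N n - j) (by omega)).2, (hδ (M n - j) (by omega)).2, ← Complex.exp_sub]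
    congr 1
    ring
  rw [hprod, ← Complex.exp_sum, ← Complex.exp_add]
  simp only [Function.comp]
  congr 1
  rw [Finset.sum_add_distrib, Finset.sum_add_distrib, ← Finset.mul_sum, ← Finset.mul_sum]
  simp only [Finset.sum_sub_distrib]
  push_cast
  ring

end Wilks

namespace Wilks

section
variable {u v : ℝ}

lemma h_sq (hu : 0 < u) (hv : 0 < v) (hv1 : v < 1) : fisherH u v ^ 2 = u + v - u * v := by
  unfold fisherH
  rw [Real.sq_sqrt]
  nlinarith

lemma h_pos (hu : 0 < u) (hv : 0 < v) (hv1 : v < 1) : 0 < fisherH u v := by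
  unfold fisherH
  apply Real.sqrt_pos.mpr
  nlinarith

lemma h_gt (hu : 0 < u) (hv : 0 < v) (hv1 : v < 1) : v < fisherH u v := by
  unfold fisherH
  apply Real.lt_sqrt_of_sq_lt
  nlinarith

lemma sqB (hu : 0 < u) (hv : 0 < v) (hv1 : v < 1) :
    Real.sqrt (1 + (v / u) * fisherB u v) = (fisherH u v + v) / (√u * (1 - v)) := by
  have h1 := h_sq hu hv hv1
  have h2 := h_pos hu hv hv1
  have h3 : 0 < 1 - v := by linarith
  have h4 : 0 < √u := Real.sqrt_pos.mpr hu
  rw [← Real.sqrt_sq (show 0 ≤ (fisherH u v + v) / (√u * (1 - v)) by positivity)]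
  congr 1
  rw [div_pow, mul_pow, Real.sq_sqrt hu.le]
  unfold fisherB
  field_simp
  linear_combination (v - 1) * h1

lemma sqA (hu : 0 < u) (hv : 0 < v) (hv1 : v < 1) :
    Real.sqrt (1 + (v / u) * fisherA u v) = (fisherH u v - v) / (√u * (1 - v)) := by
  have h1 := h_sq hu hv hv1
  have h2 := h_gt hu hv hv1
  have h2' : 0 < fisherH u v - v := by linarith
  have h3 : 0 < 1 - v := by linarith
  have h4 : 0 < √u := Real.sqrt_pos.mpr hu
  rw [← Real.sqrt_sq (show 0 ≤ (fisherH u v - v) / (√u * (1 - v)) by positivity)]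
  congr 1
  rw [div_pow, mul_pow, Real.sq_sqrt hu.le]
  unfold fisherA
  field_simp
  linear_combination (v - 1) * h1

lemma c_eq (hu : 0 < u) (hv : 0 < v) (hv1 : v < 1) :
    fisherC u v = fisherH u v / (√u * (1 - v)) := by
  unfold fisherC
  rw [sqA hu hv hv1, sqB hu hv hv1]; ring

lemma d_eq (hu : 0 < u) (hv : 0 < v) (hv1 : v < 1) :
    fisherD u v = v / (√u * (1 - v)) := by
  unfold fisherD
  rw [sqA hu hv hv1, sqB hu hv hv1]; ring

noncomputable def ww (u v : ℝ) : ℝ := -Real.log (1 - v) - Real.log ((u + v) / (u + v - u * v))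

lemma ww_eq (hu : 0 < u) (hv : 0 < v) (hv1 : v < 1) :
    ww u v = Real.log ((u + v - u * v) / ((1 - v) * (u + v))) := by
  have h3 : 0 < 1 - v := by linarith
  have h5 : 0 < u + v - u * v := by nlinarith
  unfold ww
  rw [Real.log_div (by positivity) (by positivity), Real.log_div (by positivity) (by positivity),
    Real.log_mul (by positivity) (by positivity)]
  ring

lemma ww_pos (hu : 0 < u) (hv : 0 < v) (hv1 : v < 1) : 0 < ww u v := by
  have h3 : 0 < 1 - v := by linarith
  rw [ww_eq hu hv hv1]
  apply Real.log_pos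
  rw [one_lt_div (by positivity)]
  nlinarith

lemma cd_sq (hu : 0 < u) (hv : 0 < v) (hv1 : v < 1) :
    fisherC u v ^ 2 - fisherD u v ^ 2 = (u + v) / (u * (1 - v)) := by
  have h1 := h_sq hu hv hv1
  have h3 : 0 < 1 - v := by linarith
  have h4 : 0 < √u := Real.sqrt_pos.mpr hu
  rw [c_eq hu hv hv1, d_eq hu hv hv1, div_pow, div_pow, mul_pow, Real.sq_sqrt hu.le, h1]
  field_simp
  ring

lemma ch_vd (hu : 0 < u) (hv : 0 < v) (hv1 : v < 1) :
    fisherC u v * fisherH u v - v * fisherD u v = (u + v) / √u := by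
  have h1 := h_sq hu hv hv1
  have h3 : 0 < 1 - v := by linarith
  have h4 : 0 < √u := Real.sqrt_pos.mpr hu
  rw [c_eq hu hv hv1, d_eq hu hv hv1]
  field_simp
  rw [h1]
  ring

lemma var_eq (hu : 0 < u) (hv : 0 < v) (hv1 : v < 1) : wilksVar u v = 2 * ww u v := by
  have h3 : 0 < 1 - v := by linarith
  unfold wilksVar
  rw [cd_sq hu hv hv1, ww_eq hu hv hv1, c_eq hu hv hv1, div_pow, mul_pow, Real.sq_sqrt hu.le,
    h_sq hu hv hv1]
  congr 2
  field_simp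

lemma mean_eq (hu : 0 < u) (hv : 0 < v) (hv1 : v < 1) : wilksMean u v = ww u v / 2 := by
  have h3 : 0 < 1 - v := by linarith
  unfold wilksMean
  rw [cd_sq hu hv hv1, ww_eq hu hv hv1, ch_vd hu hv hv1, div_pow, Real.sq_sqrt hu.le,
    h_sq hu hv hv1, one_div, inv_mul_eq_div]
  congr 2
  field_simp
end

lemma F_eq {p q N : ℝ} (hp : 0 < p) (hq : 0 < q) (hN : p < N) :
    p * wilksF (p / q) (p / N) = (N + q) * Real.log (N + q) - (N + q - p) * Real.log (N + q - p)
      - N * Real.log N + (N - p) * Real.log (N - p) := by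
  have hN0 : 0 < N := by linarith
  have hu : 0 < p / q := by positivity
  have hv : 0 < p / N := by positivity
  have hv1 : p / N < 1 := by rwa [div_lt_one hN0]
  have hNp : 0 < N - p := by linarith
  have hMp : 0 < N + q - p := by linarith
  have hh := h_pos hu hv hv1
  have hh2 := h_sq hu hv hv1
  have hs : 0 < √(p / q) := Real.sqrt_pos.mpr hu
  have e1v : 1 - p / N = (N - p) / N := by field_simp
  have ls : Real.log √(p / q) = (Real.log p - Real.log q) / 2 := by
    rw [Real.log_sqrt hu.le, Real.log_div hp.ne' hq.ne']
  have l1v : Real.log (1 - p / N) = Real.log (N - p) - Real.log N := by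
    rw [e1v, Real.log_div hNp.ne' hN0.ne']
  have l1v0 : 0 < 1 - p / N := by linarith
  have lh : Real.log (fisherH (p / q) (p / N))
      = (Real.log p + Real.log (N + q - p) - Real.log q - Real.log N) / 2 := by
    have : Real.log (fisherH (p / q) (p / N) ^ 2) = Real.log (p * (N + q - p) / (q * N)) := by
      rw [hh2]; congr 1; field_simp
    rw [Real.log_pow, Real.log_div (by positivity) (by positivity), Real.log_mul hp.ne' hMp.ne',
      Real.log_mul hq.ne' hN0.ne'] at this
    push_cast at this
    linarith
  have lM : Real.log (p / q + p / N) = Real.log p + Real.log (N + q) - Real.log q - Real.log N := by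
    have : p / q + p / N = p * (N + q) / (q * N) := by field_simp
    rw [this, Real.log_div (by positivity) (by positivity), Real.log_mul hp.ne' (by positivity),
      Real.log_mul hq.ne' hN0.ne']
    ring
  unfold wilksF
  have g1 : fisherC (p / q) (p / N) - fisherD (p / q) (p / N) * fisherH (p / q) (p / N)
      = fisherH (p / q) (p / N) / √(p / q) := by
    rw [c_eq hu hv hv1, d_eq hu hv hv1]
    field_simp
  have g2 : fisherC (p / q) (p / N) * fisherH (p / q) (p / N) - fisherD (p / q) (p / N) * (p / N)
      = (p / q + p / N) / √(p / q) := by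
    rw [← ch_vd hu hv hv1]; ring
  rw [g1, g2, c_eq hu hv hv1, Real.log_div hh.ne' (by positivity), Real.log_div hh.ne' hs.ne',
    Real.log_div (by positivity) hh.ne', Real.log_div (by positivity) hs.ne',
    Real.log_mul hs.ne' l1v0.ne', lM, lh, ls, l1v]
  field_simp
  ring

end Wilks

namespace Wilks

lemma final_cf (p q N : ℕ → ℕ) (hpN : ∀ n, p n ≤ N n) (y₁ y₂ : ℝ)
    (hy₁ : y₁ ∈ Set.Ioo (0 : ℝ) 1) (hy₂ : y₂ ∈ Set.Ioo (0 : ℝ) 1)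
    (hp : Tendsto p atTop atTop) (hq : Tendsto q atTop atTop) (hN : Tendsto N atTop atTop)
    (h1 : Tendsto (fun n => (p n : ℝ) / (q n : ℝ)) atTop (nhds y₁))
    (h2 : Tendsto (fun n => (p n : ℝ) / (N n : ℝ)) atTop (nhds y₂)) (s : ℂ) (hs : s.re = 0) :
    Tendsto (fun n => Complex.exp (s * ((p n : ℝ) * wilksF ((p n : ℝ) / q n) ((p n : ℝ) / N n)
      + wilksMean y₁ y₂ : ℝ)) * ∏ j ∈ Finset.range (p n), K (N n - j) s / K (N n + q n - j) s) atTop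
      (nhds (Complex.exp (s ^ 2 * ww y₁ y₂))) := by
  obtain ⟨hu, hu1⟩ := hy₁
  obtain ⟨hv, hv1⟩ := hy₂
  have hinfR : Tendsto (fun n => ((N n - p n : ℕ) : ℝ)) atTop atTop := by
    have a : Tendsto (fun n => (N n : ℝ) * (1 - (p n : ℝ) / N n)) atTop atTop :=
      Tendsto.atTop_mul_pos (by linarith : 0 < 1 - y₂)
        (tendsto_natCast_atTop_atTop.comp hN) (tendsto_const_nhds.sub h2)
    refine a.congr' ?_
    filter_upwards [hN.eventually_gt_atTop 0] with n hn
    have : (0 : ℝ) < N n := by exact_mod_cast hn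
    rw [Nat.cast_sub (hpN n)]
    field_simp
  have hinf : Tendsto (fun n => N n - p n) atTop atTop := tendsto_natCast_atTop_iff.mp hinfR
  have hw : Tendsto (fun n => (Real.log (N n) - Real.log ((N n - p n : ℕ) : ℝ))
      - (Real.log ((N n + q n : ℕ) : ℝ) - Real.log ((N n + q n - p n : ℕ) : ℝ))) atTop (nhds (ww y₁ y₂)) := by
    have a : Tendsto (fun n => -Real.log (1 - (p n : ℝ) / N n)
        - Real.log (((p n : ℝ) / q n + (p n : ℝ) / N n) /
          ((p n : ℝ) / q n + (p n : ℝ) / N n - (p n : ℝ) / q n * ((p n : ℝ) / N n)))) atTop (nhds (ww y₁ y₂)) := by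
      unfold ww
      have b1 : y₁ + y₂ - y₁ * y₂ ≠ 0 := by nlinarith
      have b2 : (y₁ + y₂) / (y₁ + y₂ - y₁ * y₂) ≠ 0 := div_ne_zero (by linarith) b1
      exact ((tendsto_const_nhds.sub h2).log (by linarith)).neg.sub
        (((h1.add h2).div ((h1.add h2).sub (h1.mul h2)) b1).log b2)
    refine a.congr' ?_
    filter_upwards [hinf.eventually_gt_atTop 0, hp.eventually_gt_atTop 0, hq.eventually_gt_atTop 0]
      with n hn hpn hqn
    have e1 : (0 : ℝ) < p n := by exact_mod_cast hpn
    have e2 : (0 : ℝ) < q n := by exact_mod_cast hqn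
    have e3 : (p n : ℝ) < N n := by exact_mod_cast (by omega : p n < N n)
    have e4 : (0 : ℝ) < N n := by linarith
    have e5 : (0 : ℝ) < N n - p n := by linarith
    have e6 : (0 : ℝ) < N n + q n - p n := by linarith
    rw [Nat.cast_sub (hpN n), Nat.cast_sub (by have := hpN n; omega)]
    push_cast
    rw [show 1 - (p n : ℝ) / N n = (N n - p n) / N n by field_simp, Real.log_div e5.ne' e4.ne',
      show ((p n : ℝ) / q n + (p n : ℝ) / N n) /
          ((p n : ℝ) / q n + (p n : ℝ) / N n - (p n : ℝ) / q n * ((p n : ℝ) / N n))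
        = (N n + q n) / (N n + q n - p n) by
        have : (p n : ℝ) / q n + (p n : ℝ) / N n - (p n : ℝ) / q n * ((p n : ℝ) / N n)
          = p n * (N n + q n - p n) / (q n * N n) := by field_simp
        rw [this]
        field_simp, Real.log_div (by positivity) e6.ne']
    ring
  have hsq : Tendsto (fun n => (p n : ℝ) / ((N n - p n : ℕ) : ℝ) ^ 2) atTop (nhds 0) := by
    have a := (h2.div (tendsto_const_nhds.sub h2) (by linarith : (1 : ℝ) - y₂ ≠ 0)).mul
      (tendsto_inv_atTop_zero.comp hinfR)
    rw [mul_zero] at a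
    refine a.congr' ?_
    filter_upwards [hinf.eventually_gt_atTop 0] with n hn
    have e3 : (p n : ℝ) < N n := by exact_mod_cast (by omega : p n < N n)
    have e4 : (0 : ℝ) < N n := by
      have : (0 : ℝ) ≤ p n := Nat.cast_nonneg _
      linarith
    have e5 : (0 : ℝ) < N n - p n := by linarith
    simp only [Function.comp, Pi.div_apply]
    rw [Nat.cast_sub (hpN n), show 1 - (p n : ℝ) / N n = (N n - p n) / N n by field_simp]
    field_simp
  have H := (prod_lim p N (fun n => N n + q n) hpN (fun n => Nat.le_add_right _ _) hinf (ww y₁ y₂) hw hsq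
    s hs).const_mul (Complex.exp (s * (wilksMean y₁ y₂ : ℂ)))
  rw [← Complex.exp_add, mean_eq hu hv hv1] at H
  rw [mean_eq hu hv hv1, show s ^ 2 * (ww y₁ y₂ : ℂ) = s * ((ww y₁ y₂ / 2 : ℝ) : ℂ) + (s * ((ww y₁ y₂ / 2 : ℝ) : ℂ)
    + s * (s - 1) * ww y₁ y₂) by push_cast; ring]
  refine H.congr' ?_
  filter_upwards [hinf.eventually_gt_atTop 0, hp.eventually_gt_atTop 0, hq.eventually_gt_atTop 0]
    with n hn hpn hqn
  have e1 : (0 : ℝ) < p n := by exact_mod_cast hpn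
  have e2 : (0 : ℝ) < q n := by exact_mod_cast hqn
  have e3 : (p n : ℝ) < N n := by exact_mod_cast (by omega : p n < N n)
  rw [← mul_assoc, ← Complex.exp_add, F_eq e1 e2 e3]
  congr 2
  unfold GG
  rw [Nat.cast_sub (hpN n), Nat.cast_sub (by have := hpN n; omega)]
  push_cast
  ring

lemma levy {Ω : ℕ → Type*} [∀ n, MeasurableSpace (Ω n)] (P : ∀ n, Measure (Ω n))
    [∀ n, IsProbabilityMeasure (P n)] (T : ∀ n, Ω n → ℝ) (hT : ∀ n, Measurable (T n))
    (h : ∀ t : ℝ, Tendsto (fun n => ∫ ω, Complex.exp (t * T n ω * Complex.I) ∂(P n)) atTop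
      (nhds (Complex.exp (-(t : ℂ) ^ 2 / 2)))) (g : BoundedContinuousFunction ℝ ℝ) :
    Tendsto (fun n => ∫ ω, g (T n ω) ∂(P n)) atTop (nhds (∫ v, g v ∂(gaussianReal 0 1))) := by
  let μ : ℕ → ProbabilityMeasure ℝ := fun n =>
    ⟨(P n).map (T n), Measure.isProbabilityMeasure_map (hT n).aemeasurable⟩
  let μ₀ : ProbabilityMeasure ℝ := ⟨gaussianReal 0 1, inferInstance⟩
  have hμ : Tendsto μ atTop (nhds μ₀) := by
    apply ProbabilityMeasure.tendsto_of_tendsto_charFun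
    intro t
    change Tendsto (fun n => charFun ((P n).map (T n)) t) atTop (nhds (charFun (gaussianReal 0 1) t))
    rw [charFun_gaussianReal]
    convert h t using 2
    · rename_i n
      rw [charFun_apply_real, integral_map (hT n).aemeasurable (by fun_prop)]
    · simp
      ring_nf
  have := (ProbabilityMeasure.tendsto_iff_forall_integral_tendsto.mp hμ) g
  refine this.congr fun n => ?_
  change ∫ x, g x ∂((P n).map (T n)) = _
  rw [integral_map (hT n).aemeasurable g.continuous.aestronglyMeasurable]

end Wilks

/-- corrected LRT for a general linear hypothesis in high-dimensional
multivariate regression.  The models are indexed by the sample size `n`; the regressor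
index type is `Fin (q₁ n) ⊕ Fin (q₂ n)` (first and second blocks).  The noise vectors are
i.i.d. `N_p(0,Σ)` (expressed through independence plus the Gaussianity of all linear
functionals), the null hypothesis `B₁ = B₁*` holds, `Z` has full rank `q` and `n ≥ p + q`.
Under `p, q₁, n−q → ∞`, `p/q₁ → y₁ ∈ (0,1)`, `p/(n−q) → y₂ ∈ (0,1)`, the statistic
`T_n = v^{−1/2}(−log Λ_n − p F_n − m)` converges in distribution to `N(0,1)`. -/
theorem stmt7
    (p q₁ q₂ : ℕ → ℕ)
    (Ω : ℕ → Type) [∀ n, MeasurableSpace (Ω n)] (P : ∀ n, Measure (Ω n))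
    (hP : ∀ n, IsProbabilityMeasure (P n))
    (B : ∀ n, Matrix (Fin (p n)) (Fin (q₁ n) ⊕ Fin (q₂ n)) ℝ)
    (B₁star : ∀ n, Matrix (Fin (p n)) (Fin (q₁ n)) ℝ)
    (z : ∀ n, Fin n → (Fin (q₁ n) ⊕ Fin (q₂ n)) → ℝ)
    (Sig : ∀ n, Matrix (Fin (p n)) (Fin (p n)) ℝ)
    (ε : ∀ n, Fin n → Ω n → (Fin (p n) → ℝ))
    (hmeas : ∀ n i, Measurable (ε n i))
    (hSigpos : ∀ n, (Sig n).PosDef)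
    -- the noise vectors are independent ...
    (hindep : ∀ n, iIndepFun (ε n) (P n))
    -- ... and each is a centered Gaussian vector with covariance matrix `Σ`
    (hgauss : ∀ n (i : Fin n) (u : Fin (p n) → ℝ),
      Measure.map (fun ω => ∑ j, u j * ε n i ω j) (P n) =
        gaussianReal 0 (Real.toNNReal (∑ j, ∑ l, u j * Sig n j l * u l)))
    -- `Z = (z₁,…,z_n)` has full rank `q = q₁ + q₂`
    (hrank : ∀ n,
      (Matrix.of fun (a : Fin (q₁ n) ⊕ Fin (q₂ n)) (i : Fin n) => z n i a).rank = q₁ n + q₂ n)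
    -- `n ≥ p + q`
    (hsize : ∀ n, p n + (q₁ n + q₂ n) ≤ n)
    -- the null hypothesis `H₀ : B₁ = B₁*`
    (hnull : ∀ n a j, B n a (Sum.inl j) = B₁star n a j)
    (y₁ y₂ : ℝ) (hy₁ : y₁ ∈ Set.Ioo (0 : ℝ) 1) (hy₂ : y₂ ∈ Set.Ioo (0 : ℝ) 1)
    (hp : Tendsto p atTop atTop) (hq₁ : Tendsto q₁ atTop atTop)
    (hnq : Tendsto (fun n => n - (q₁ n + q₂ n)) atTop atTop)
    (hyn1 : Tendsto (fun n => (p n : ℝ) / (q₁ n : ℝ)) atTop (nhds y₁))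
    (hyn2 : Tendsto (fun n => (p n : ℝ) / ((n : ℝ) - ((q₁ n + q₂ n : ℕ) : ℝ))) atTop (nhds y₂)) :
    -- the observations of the regression model
    let x : ∀ n, Fin n → Ω n → (Fin (p n) → ℝ) :=
      fun n i ω => (B n).mulVec (z n i) + ε n i ω
    -- `Σᵢ zᵢ zᵢᵀ` and the MLE `B̂` under the alternative
    let A : ∀ n, Matrix (Fin (q₁ n) ⊕ Fin (q₂ n)) (Fin (q₁ n) ⊕ Fin (q₂ n)) ℝ :=
      fun n => ∑ i, vecMulVec (z n i) (z n i)
    let Bhat : ∀ n, Ω n → Matrix (Fin (p n)) (Fin (q₁ n) ⊕ Fin (q₂ n)) ℝ :=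
      fun n ω => (∑ i, vecMulVec (x n i ω) (z n i)) * (A n)⁻¹
    -- the MLE `Σ̂` under the alternative
    let Sighat : ∀ n, Ω n → Matrix (Fin (p n)) (Fin (p n)) ℝ :=
      fun n ω => ((n : ℝ))⁻¹ • ∑ i,
        vecMulVec (x n i ω - (Bhat n ω).mulVec (z n i)) (x n i ω - (Bhat n ω).mulVec (z n i))
    -- `yᵢ = xᵢ − B₁* z_{i,1}` and the MLEs under the null
    let yvec : ∀ n, Fin n → Ω n → (Fin (p n) → ℝ) :=
      fun n i ω => x n i ω - (B₁star n).mulVec (fun j => z n i (Sum.inl j))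
    let A22 : ∀ n, Matrix (Fin (q₂ n)) (Fin (q₂ n)) ℝ :=
      fun n => ∑ i, vecMulVec (fun j => z n i (Sum.inr j)) (fun j => z n i (Sum.inr j))
    let Bhat20 : ∀ n, Ω n → Matrix (Fin (p n)) (Fin (q₂ n)) ℝ :=
      fun n ω => (∑ i, vecMulVec (yvec n i ω) (fun j => z n i (Sum.inr j))) * (A22 n)⁻¹
    let Sighat0 : ∀ n, Ω n → Matrix (Fin (p n)) (Fin (p n)) ℝ :=
      fun n ω => ((n : ℝ))⁻¹ • ∑ i,
        vecMulVec (yvec n i ω - (Bhat20 n ω).mulVec (fun j => z n i (Sum.inr j)))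
          (yvec n i ω - (Bhat20 n ω).mulVec (fun j => z n i (Sum.inr j)))
    -- Wilk's likelihood ratio statistic
    let Λ : ∀ n, Ω n → ℝ := fun n ω => (Sighat n ω).det / (Sighat0 n ω).det
    let yn1 : ℕ → ℝ := fun n => (p n : ℝ) / (q₁ n : ℝ)
    let yn2 : ℕ → ℝ := fun n => (p n : ℝ) / ((n : ℝ) - ((q₁ n + q₂ n : ℕ) : ℝ))
    -- `T_n` converges in distribution to `N(0,1)`
    ∀ g : BoundedContinuousFunction ℝ ℝ,
      Tendsto
        (fun n => ∫ ω,
          g ((Real.sqrt (wilksVar y₁ y₂))⁻¹ *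
            (-(Real.log (Λ n ω)) - (p n : ℝ) * wilksF (yn1 n) (yn2 n) - wilksMean y₁ y₂)) ∂(P n))
        atTop (nhds (∫ v, g v ∂(gaussianReal 0 1))) := by
  intro x A Bhat Sighat yvec A22 Bhat20 Sighat0 Λ yn1 yn2
  have hv := Wilks.ww_pos hy₁.1 hy₂.1 hy₂.2
  have main : ∀ n, Measurable (Λ n) ∧ ∀ s : ℂ, s.re = 0 →
      ∫ ω, Complex.exp (s * (Real.log (Λ n ω) : ℂ)) ∂(P n)
        = ∏ j ∈ Finset.range (p n), Wilks.K (n - (q₁ n + q₂ n) - j) s / Wilks.K (n - q₂ n - j) s := by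
    intro n
    have := hP n
    exact Wilks.wilks_cf (P n) (B n) (B₁star n) (z n) (Sig n) (ε n) (hmeas n) (hSigpos n) (hindep n)
      (hgauss n) (hrank n) (hsize n) (hnull n) (x n) (yvec n) (fun _ _ => rfl) (fun _ _ => rfl)
      (Bhat n) (fun _ => rfl) (Bhat20 n) (fun _ => rfl) (Λ n) (fun _ => rfl)
  have hcast : ∀ n : ℕ, (n : ℝ) - ((q₁ n + q₂ n : ℕ) : ℝ) = ((n - (q₁ n + q₂ n) : ℕ) : ℝ) := by
    intro n
    rw [Nat.cast_sub (by have := hsize n; omega)]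
  have := hP
  refine Wilks.levy P (fun n ω => (Real.sqrt (wilksVar y₁ y₂))⁻¹ *
    (-(Real.log (Λ n ω)) - (p n : ℝ) * wilksF (yn1 n) (yn2 n) - wilksMean y₁ y₂)) ?_ ?_
  · intro n
    have := (main n).1
    fun_prop
  · intro t
    set r : ℝ := (Real.sqrt (wilksVar y₁ y₂))⁻¹ with hr
    set s : ℂ := -((t * r : ℝ) : ℂ) * Complex.I with hsdef
    have hs : s.re = 0 := by simp [hsdef]
    have hyn2' : Tendsto (fun n => (p n : ℝ) / ((n - (q₁ n + q₂ n) : ℕ) : ℝ)) atTop (nhds y₂) := by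
      simpa only [hcast] using hyn2
    have H := Wilks.final_cf p q₁ (fun n => n - (q₁ n + q₂ n)) (fun n => by have := hsize n; omega)
      y₁ y₂ hy₁ hy₂ hp hq₁ hnq hyn1 hyn2' s hs
    have hlim : s ^ 2 * (Wilks.ww y₁ y₂ : ℂ) = -(t : ℂ) ^ 2 / 2 := by
      have hr2 : r ^ 2 * Wilks.ww y₁ y₂ = 1 / 2 := by
        rw [hr, Wilks.var_eq hy₁.1 hy₂.1 hy₂.2, inv_pow, Real.sq_sqrt (by positivity)]
        field_simp
      have hr2c : (r : ℂ) ^ 2 * (Wilks.ww y₁ y₂ : ℂ) = 1 / 2 := by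
        have := congrArg (fun a : ℝ => (a : ℂ)) hr2
        push_cast at this
        exact this
      rw [hsdef]
      push_cast
      have hI := Complex.I_sq
      linear_combination ((t : ℂ) ^ 2 * r ^ 2 * (Wilks.ww y₁ y₂ : ℂ)) * hI - (t : ℂ) ^ 2 * hr2c
    rw [hlim] at H
    refine H.congr fun n => ?_
    have hM : n - (q₁ n + q₂ n) + q₁ n = n - q₂ n := by have := hsize n; omega
    rw [hM, ← (main n).2 s hs, ← integral_const_mul]
    congr 1
    funext ω
    rw [← Complex.exp_add]
    congr 1
    have hy2 : yn2 n = (p n : ℝ) / ((n - (q₁ n + q₂ n) : ℕ) : ℝ) := by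
      rw [← hcast]
    rw [← hy2]
    change s * (((p n : ℝ) * wilksF (yn1 n) (yn2 n) + wilksMean y₁ y₂ : ℝ) : ℂ) + s * (Real.log (Λ n ω) : ℂ) = _
    rw [hsdef]
    push_cast
    ring
end
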